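/- arXiv:2604.03722 — 3 statements merged into one kernel-verified Lean document; each statement's English description precedes it below -/
import Mathlib

section
/- Consider the physical fractional Brownian motion model with Hurst parameter H ∈ (0,1), noise intensity σ > 0 and fixed horizon T > 0. Suppose ε ↦ δ(ε) is such that δ(ε) → 0 and ε/δ(ε) → 0 as ε → 0⁺ (along values for which N = T/δ(ε) is a positive integer). Then the second-order-increment estimator of the Hurst parameter, Ĥ_{δ,ε} = 1/2 − (1/(2 ln 2)) ln( Σ_{k=2}^{2N} (Δ^{(2)}_{k,δ/2} X^ε)² / Σ_{k=2}^{N} (Δ^{(2)}_{k,δ} X^ε)² ), converges to H in probability as ε → 0⁺. -/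
open MeasureTheory ProbabilityTheory Filter Matrix Topology

noncomputable section

/-- Covariance function of two-sided fractional Brownian motion with Hurst parameter `H`. -/
def fbmCov (H s t : ℝ) : ℝ :=
  (|s| ^ (2 * H) + |t| ^ (2 * H) - |s - t| ^ (2 * H)) / 2

/-- `B` is a two-sided fractional Brownian motion with Hurst parameter `H`:
a.s. continuous paths, `B 0 = 0`, and all finite-dimensional marginals are centered
Gaussian with covariance `fbmCov H`. -/
structure IsTwoSidedFBM {Ω : Type*} [MeasureSpace Ω] (H : ℝ) (B : ℝ → Ω → ℝ) : Prop where
  meas : ∀ t, Measurable (B t)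
  cont : ∀ᵐ ω : Ω, Continuous fun t => B t ω
  zero : ∀ᵐ ω : Ω, B 0 ω = 0
  gaussian : ∀ (n : ℕ) (t a : Fin n → ℝ),
    Measure.map (fun ω => ∑ i, a i * B (t i) ω) (ℙ : Measure Ω)
      = gaussianReal 0 (∑ i, ∑ j, a i * a j * fbmCov H (t i) (t j)).toNNReal

/-- The stationary fractional Ornstein–Uhlenbeck process
`Y^ε_t = (σ/ε^H)(B^H_t − (1/ε)∫_{−∞}^t e^{−(t−s)/ε} B^H_s ds)`. -/
def fracOU {Ω : Type*} [MeasureSpace Ω] (H σ ε : ℝ) (B : ℝ → Ω → ℝ) (t : ℝ) (ω : Ω) : ℝ :=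
  (σ / ε ^ H) * (B t ω - (1 / ε) * ∫ s in Set.Iic t, Real.exp (-(t - s) / ε) * B s ω)

/-- The slow component `X^ε_t = ε^{H−1} ∫_0^t Y^ε_s ds` of the physical fractional
Brownian motion model. -/
def slowX {Ω : Type*} [MeasureSpace Ω] (H σ ε : ℝ) (B : ℝ → Ω → ℝ) (t : ℝ) (ω : Ω) : ℝ :=
  ε ^ (H - 1) * ∫ s in (0 : ℝ)..t, fracOU H σ ε B s ω

/-- Second-order increment `Δ^{(2)}_{k,δ} f = f(kδ) − 2 f((k−1)δ) + f((k−2)δ)`. -/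
def secondInc (f : ℝ → ℝ) (δ : ℝ) (k : ℕ) : ℝ :=
  f ((k : ℝ) * δ) - 2 * f (((k : ℝ) - 1) * δ) + f (((k : ℝ) - 2) * δ)

/-- The second-order-increment estimator of the Hurst parameter. -/
def hurstHat {Ω : Type*} [MeasureSpace Ω] (H σ ε δ : ℝ) (B : ℝ → Ω → ℝ) (N : ℕ) (ω : Ω) : ℝ :=
  1 / 2 - (1 / (2 * Real.log 2)) *
    Real.log
      ((∑ k ∈ Finset.Icc 2 (2 * N), (secondInc (fun t => slowX H σ ε B t ω) (δ / 2) k) ^ 2)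
        / (∑ k ∈ Finset.Icc 2 N, (secondInc (fun t => slowX H σ ε B t ω) δ k) ^ 2))

theorem iteratedDeriv_four_exp_sq (v : ℝ) :
    iteratedDeriv 4 (fun t : ℝ => Real.exp (v * t ^ 2 / 2)) 0 = 3 * v ^ 2 := by
  have e : ∀ t : ℝ, HasDerivAt (fun t : ℝ => Real.exp (v * t ^ 2 / 2))
      (v * t * Real.exp (v * t ^ 2 / 2)) t := fun t => by
    refine (((hasDerivAt_pow 2 t).const_mul v).div_const 2).exp.congr_deriv ?_
    norm_num
    ring
  have key : ∀ (q q' : ℝ → ℝ), (∀ t, HasDerivAt q (q' t) t) →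
      deriv (fun t => q t * Real.exp (v * t ^ 2 / 2))
        = fun t => (q' t + v * t * q t) * Real.exp (v * t ^ 2 / 2) := by
    intro q q' hq
    funext t
    rw [((hq t).fun_mul (e t)).deriv]
    ring
  have d1 : deriv (fun t : ℝ => Real.exp (v * t ^ 2 / 2))
      = fun t => v * t * Real.exp (v * t ^ 2 / 2) := funext fun t => (e t).deriv
  have p1 : ∀ t : ℝ, HasDerivAt (fun t : ℝ => v * t) v t := fun t => by
    simpa using (hasDerivAt_id t).const_mul v
  have p2 : ∀ t : ℝ, HasDerivAt (fun t : ℝ => v + v * t * (v * t)) (2 * v ^ 2 * t) t := fun t => by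
    refine (((p1 t).fun_mul (p1 t)).const_add v).congr_deriv ?_
    ring
  have p3 : ∀ t : ℝ, HasDerivAt (fun t : ℝ => 2 * v ^ 2 * t + v * t * (v + v * t * (v * t)))
      (3 * v ^ 2 + 3 * v ^ 3 * t ^ 2) t := fun t => by
    have h1 : HasDerivAt (fun t : ℝ => 2 * v ^ 2 * t) (2 * v ^ 2) t := by
      simpa using (hasDerivAt_id t).const_mul (2 * v ^ 2)
    refine (h1.fun_add ((p1 t).fun_mul (p2 t))).congr_deriv ?_
    ring
  rw [iteratedDeriv_succ', iteratedDeriv_succ', iteratedDeriv_succ', iteratedDeriv_succ',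
    iteratedDeriv_zero, d1, key _ _ p1, key _ _ p2, key _ _ p3]
  simp

section Gaussian

variable {Ω : Type*} {mΩ : MeasurableSpace Ω} {P : Measure Ω}

theorem integral_pow_four_gaussianReal (v : NNReal) :
    ∫ x, x ^ 4 ∂(gaussianReal 0 v) = 3 * (v : ℝ) ^ 2 := by
  have h := iteratedDeriv_mgf_zero (X := id) (μ := gaussianReal 0 v) (by simp) 4
  have hm : mgf id (gaussianReal 0 v) = fun t => Real.exp (v * t ^ 2 / 2) := by
    rw [mgf_id_gaussianReal]; simp
  rw [hm, iteratedDeriv_four_exp_sq] at h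
  simpa using h.symm

theorem integral_sq_gaussianReal (v : NNReal) :
    ∫ x, x ^ 2 ∂(gaussianReal 0 v) = v := by
  have h := variance_fun_id_gaussianReal (μ := 0) (v := v)
  rw [variance_eq_integral (by fun_prop)] at h
  simpa using h

theorem memLp_of_map_eq_gaussianReal {Z : Ω → ℝ} {v : NNReal} (hm : AEMeasurable Z P)
    (h : P.map Z = gaussianReal 0 v) (p : NNReal) : MemLp Z p P := by
  have := memLp_id_gaussianReal (μ := 0) (v := v) p
  rw [← h] at this
  exact (memLp_map_measure_iff (by fun_prop) hm).1 this

theorem integral_sq_of_map_eq_gaussianReal {Z : Ω → ℝ} {v : NNReal} (hm : AEMeasurable Z P)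
    (h : P.map Z = gaussianReal 0 v) : ∫ ω, Z ω ^ 2 ∂P = v := by
  rw [← integral_sq_gaussianReal v, ← h, integral_map hm (by fun_prop)]

theorem integral_pow_four_of_map_eq_gaussianReal {Z : Ω → ℝ} {v : NNReal} (hm : AEMeasurable Z P)
    (h : P.map Z = gaussianReal 0 v) : ∫ ω, Z ω ^ 4 ∂P = 3 * (∫ ω, Z ω ^ 2 ∂P) ^ 2 := by
  rw [integral_sq_of_map_eq_gaussianReal hm h, ← integral_pow_four_gaussianReal v, ← h,
    integral_map hm (by fun_prop)]

theorem MeasureTheory.MemLp.integrable_sq_mul_sq {X Y : Ω → ℝ} (hX : MemLp X 4 P)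
    (hY : MemLp Y 4 P) : Integrable (fun ω => X ω ^ 2 * Y ω ^ 2) P := by
  have hX4 : Integrable (fun ω => ‖X ω‖ ^ 4) P := hX.integrable_norm_pow (p := 4) (by norm_num)
  have hY4 : Integrable (fun ω => ‖Y ω‖ ^ 4) P := hY.integrable_norm_pow (p := 4) (by norm_num)
  refine (hX4.add hY4).mono' ((hX.1.pow 2).mul (hY.1.pow 2)) (ae_of_all _ fun ω => ?_)
  have h1 : ‖X ω‖ ^ 4 = X ω ^ 4 := by rw [Real.norm_eq_abs]; exact Even.pow_abs (by decide) _
  have h2 : ‖Y ω‖ ^ 4 = Y ω ^ 4 := by rw [Real.norm_eq_abs]; exact Even.pow_abs (by decide) _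
  simp only [Pi.add_apply, h1, h2]
  rw [Real.norm_of_nonneg (by positivity)]
  nlinarith [sq_nonneg (X ω ^ 2 - Y ω ^ 2), sq_nonneg (X ω ^ 2), sq_nonneg (Y ω ^ 2)]

/-- **Isserlis' formula** for the second moments of the squares of two centered jointly Gaussian
variables, with joint Gaussianity expressed through the two combinations `X ± Y`. -/
theorem integral_sq_mul_sq_of_gaussian [IsFiniteMeasure P] {X Y : Ω → ℝ}
    (hX : MemLp X 4 P) (hY : MemLp Y 4 P)
    (gX : ∫ ω, X ω ^ 4 ∂P = 3 * (∫ ω, X ω ^ 2 ∂P) ^ 2)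
    (gY : ∫ ω, Y ω ^ 4 ∂P = 3 * (∫ ω, Y ω ^ 2 ∂P) ^ 2)
    (gA : ∫ ω, (X ω + Y ω) ^ 4 ∂P = 3 * (∫ ω, (X ω + Y ω) ^ 2 ∂P) ^ 2)
    (gS : ∫ ω, (X ω - Y ω) ^ 4 ∂P = 3 * (∫ ω, (X ω - Y ω) ^ 2 ∂P) ^ 2) :
    ∫ ω, X ω ^ 2 * Y ω ^ 2 ∂P
      = (∫ ω, X ω ^ 2 ∂P) * (∫ ω, Y ω ^ 2 ∂P) + 2 * (∫ ω, X ω * Y ω ∂P) ^ 2 := by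
  have pow4 : ∀ {Z : Ω → ℝ}, MemLp Z 4 P → Integrable (fun ω => Z ω ^ 4) P := fun {Z} hZ => by
    simpa [← pow_add] using hZ.integrable_sq_mul_sq hZ
  have hX2 := hX.mono_exponent (p := 2) (by norm_num)
  have hY2 := hY.mono_exponent (p := 2) (by norm_num)
  have iX := hX2.integrable_sq
  have iY := hY2.integrable_sq
  have iXY : Integrable (fun ω => X ω * Y ω) P := hX2.integrable_mul hY2
  have iS : Integrable (fun ω => X ω ^ 2 + Y ω ^ 2) P := iX.add iY
  have jA : Integrable (fun ω => (X ω + Y ω) ^ 4) P := pow4 (hX.add hY)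
  have jS : Integrable (fun ω => (X ω - Y ω) ^ 4) P := pow4 (hX.sub hY)
  have j4 : Integrable (fun ω => X ω ^ 4 + Y ω ^ 4) P := (pow4 hX).add (pow4 hY)
  have jAS : Integrable (fun ω => (X ω + Y ω) ^ 4 + (X ω - Y ω) ^ 4) P := jA.add jS
  have eA : ∫ ω, (X ω + Y ω) ^ 2 ∂P
      = (∫ ω, X ω ^ 2 ∂P) + (∫ ω, Y ω ^ 2 ∂P) + 2 * ∫ ω, X ω * Y ω ∂P := by
    rw [← integral_add iX iY, ← integral_const_mul, ← integral_add iS (iXY.const_mul 2)]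
    congr 1; ext ω; ring
  have eS : ∫ ω, (X ω - Y ω) ^ 2 ∂P
      = (∫ ω, X ω ^ 2 ∂P) + (∫ ω, Y ω ^ 2 ∂P) - 2 * ∫ ω, X ω * Y ω ∂P := by
    rw [← integral_add iX iY, ← integral_const_mul, ← integral_sub iS (iXY.const_mul 2)]
    congr 1; ext ω; ring
  have e4 : 12 * ∫ ω, X ω ^ 2 * Y ω ^ 2 ∂P
      = (∫ ω, (X ω + Y ω) ^ 4 ∂P) + (∫ ω, (X ω - Y ω) ^ 4 ∂P)
        - 2 * ((∫ ω, X ω ^ 4 ∂P) + ∫ ω, Y ω ^ 4 ∂P) := by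
    rw [← integral_add jA jS, ← integral_add (pow4 hX) (pow4 hY), ← integral_const_mul,
      ← integral_const_mul, ← integral_sub jAS (j4.const_mul 2)]
    congr 1; ext ω; ring
  rw [gX, gY, gA, gS, eA, eS] at e4
  linear_combination e4 / 12

end Gaussian

/-- Correlation function of the second-order increments of fractional Brownian motion on the unit
grid. -/
def secondIncCorr (H x : ℝ) : ℝ :=
  -(|x + 2| ^ (2 * H) - 4 * |x + 1| ^ (2 * H) + 6 * |x| ^ (2 * H) - 4 * |x - 1| ^ (2 * H)
    + |x - 2| ^ (2 * H)) / 2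

theorem secondIncCorr_neg (H x : ℝ) : secondIncCorr H (-x) = secondIncCorr H x := by
  unfold secondIncCorr
  rw [show -x + 2 = -(x - 2) by ring, show -x + 1 = -(x - 1) by ring,
    show -x - 1 = -(x + 1) by ring, show -x - 2 = -(x + 2) by ring]
  simp only [abs_neg]
  ring

theorem secondIncCorr_zero {H : ℝ} (hH : 0 < H) : secondIncCorr H 0 = 4 - 2 ^ (2 * H) := by
  have h : (0 : ℝ) ^ (2 * H) = 0 := Real.zero_rpow (by positivity)
  unfold secondIncCorr
  simp [h]
  ring

namespace IsTwoSidedFBM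

variable {Ω : Type*} [MeasureSpace Ω] {H : ℝ} {B : ℝ → Ω → ℝ}

theorem measurable_sum (hB : IsTwoSidedFBM H B) {n : ℕ} (t a : Fin n → ℝ) :
    Measurable fun ω => ∑ i, a i * B (t i) ω :=
  Finset.measurable_sum _ fun i _ => (hB.meas (t i)).const_mul (a i)

theorem memLp_sum (hB : IsTwoSidedFBM H B) {n : ℕ} (t a : Fin n → ℝ) (p : NNReal) :
    MemLp (fun ω => ∑ i, a i * B (t i) ω) p ℙ :=
  memLp_of_map_eq_gaussianReal (hB.measurable_sum t a).aemeasurable (hB.gaussian n t a) p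

theorem integral_sum_pow_four (hB : IsTwoSidedFBM H B) {n : ℕ} (t a : Fin n → ℝ) :
    ∫ ω, (∑ i, a i * B (t i) ω) ^ 4 = 3 * (∫ ω, (∑ i, a i * B (t i) ω) ^ 2) ^ 2 :=
  integral_pow_four_of_map_eq_gaussianReal (hB.measurable_sum t a).aemeasurable
    (hB.gaussian n t a)

theorem memLp (hB : IsTwoSidedFBM H B) (t : ℝ) (p : NNReal) : MemLp (B t) p ℙ := by
  simpa using hB.memLp_sum (fun _ : Fin 1 => t) (fun _ => 1) p

theorem integral_sq (hB : IsTwoSidedFBM H B) (hH : 0 < H) (t : ℝ) :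
    ∫ ω, B t ω ^ 2 = |t| ^ (2 * H) := by
  have h := integral_sq_of_map_eq_gaussianReal
    (hB.measurable_sum (fun _ : Fin 1 => t) (fun _ => 1)).aemeasurable (hB.gaussian 1 _ _)
  have h0 : (0 : ℝ) ^ (2 * H) = 0 := Real.zero_rpow (by positivity)
  have h1 : 0 ≤ |t| ^ (2 * H) := by positivity
  simpa [fbmCov, h0, h1] using h

theorem integral_sub_sq (hB : IsTwoSidedFBM H B) (hH : 0 < H) (s t : ℝ) :
    ∫ ω, (B s ω - B t ω) ^ 2 = |s - t| ^ (2 * H) := by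
  have h := integral_sq_of_map_eq_gaussianReal
    (hB.measurable_sum ![s, t] ![1, -1]).aemeasurable (hB.gaussian 2 _ _)
  have h0 : (0 : ℝ) ^ (2 * H) = 0 := Real.zero_rpow (by positivity)
  have h1 : 0 ≤ |s - t| ^ (2 * H) := by positivity
  simp only [fbmCov, Fin.sum_univ_two, Matrix.cons_val_zero, Matrix.cons_val_one, sub_self,
    abs_zero, h0, abs_sub_comm t s] at h
  ring_nf at h
  rw [Real.coe_toNNReal _ (by rwa [mul_comm H 2]), mul_comm H 2] at h
  rw [← h]
  congr 1; ext ω; ring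

theorem integrable_mul (hB : IsTwoSidedFBM H B) (s t : ℝ) :
    Integrable (fun ω => B s ω * B t ω) :=
  MemLp.integrable_mul (p := 2) (q := 2) (hB.memLp s 2) (hB.memLp t 2)

theorem integral_mul (hB : IsTwoSidedFBM H B) (hH : 0 < H) (s t : ℝ) :
    ∫ ω, B s ω * B t ω = fbmCov H s t := by
  have is : Integrable (fun ω => B s ω ^ 2) := by
    simpa [sq] using hB.integrable_mul s s
  have it : Integrable (fun ω => B t ω ^ 2) := by
    simpa [sq] using hB.integrable_mul t t
  have ist : Integrable (fun ω => B s ω ^ 2 + B t ω ^ 2) := is.add it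
  have h := hB.integral_sub_sq hH s t
  have e : ∫ ω, (B s ω - B t ω) ^ 2
      = (∫ ω, B s ω ^ 2) + (∫ ω, B t ω ^ 2) - 2 * ∫ ω, B s ω * B t ω := by
    rw [← integral_add is it, ← integral_const_mul,
      ← integral_sub ist ((hB.integrable_mul s t).const_mul 2)]
    congr 1; ext ω; ring
  rw [e, hB.integral_sq hH, hB.integral_sq hH] at h
  unfold fbmCov
  linarith

theorem integral_sum_mul_sum (hB : IsTwoSidedFBM H B) (hH : 0 < H) {m n : ℕ}
    (s a : Fin m → ℝ) (t b : Fin n → ℝ) :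
    ∫ ω, (∑ i, a i * B (s i) ω) * (∑ j, b j * B (t j) ω)
      = ∑ i, ∑ j, a i * b j * fbmCov H (s i) (t j) := by
  simp_rw [Finset.sum_mul_sum]
  have hi : ∀ i j, Integrable (fun ω => a i * B (s i) ω * (b j * B (t j) ω)) := fun i j => by
    refine ((hB.integrable_mul (s i) (t j)).const_mul (a i * b j)).congr (ae_of_all _ fun ω => ?_)
    simp only; ring
  rw [integral_finsetSum _ fun i _ => integrable_finsetSum _ fun j _ => hi i j]
  refine Finset.sum_congr rfl fun i _ => ?_
  rw [integral_finsetSum _ fun j _ => hi i j]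
  refine Finset.sum_congr rfl fun j _ => ?_
  rw [← hB.integral_mul hH, ← integral_const_mul]
  congr 1; ext ω; ring

theorem secondInc_eq_sum {Ω : Type*} (B : ℝ → Ω → ℝ) (δ : ℝ) (k : ℕ) (ω : Ω) :
    secondInc (fun t => B t ω) δ k
      = ∑ i, (![1, -2, 1] : Fin 3 → ℝ) i
        * B ((![k * δ, (k - 1) * δ, (k - 2) * δ] : Fin 3 → ℝ) i) ω := by
  simp [secondInc, Fin.sum_univ_three]
  ring

theorem memLp_secondInc (hB : IsTwoSidedFBM H B) (δ : ℝ) (k : ℕ) (p : NNReal) :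
    MemLp (fun ω => secondInc (fun t => B t ω) δ k) p ℙ := by
  simp_rw [secondInc_eq_sum]
  exact hB.memLp_sum _ _ p

theorem integral_secondInc_pow_four (hB : IsTwoSidedFBM H B) (δ : ℝ) (k : ℕ) :
    ∫ ω, secondInc (fun t => B t ω) δ k ^ 4
      = 3 * (∫ ω, secondInc (fun t => B t ω) δ k ^ 2) ^ 2 := by
  simp_rw [secondInc_eq_sum]
  exact hB.integral_sum_pow_four _ _

theorem integral_add_secondInc_pow_four (hB : IsTwoSidedFBM H B) (δ c : ℝ) (j k : ℕ) :
    ∫ ω, (secondInc (fun t => B t ω) δ j + c * secondInc (fun t => B t ω) δ k) ^ 4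
      = 3 * (∫ ω, (secondInc (fun t => B t ω) δ j + c * secondInc (fun t => B t ω) δ k) ^ 2) ^ 2 := by
  have h : ∀ ω, secondInc (fun t => B t ω) δ j + c * secondInc (fun t => B t ω) δ k
      = ∑ i, (![1, -2, 1, c, -2 * c, c] : Fin 6 → ℝ) i
        * B ((![j * δ, (j - 1) * δ, (j - 2) * δ, k * δ, (k - 1) * δ, (k - 2) * δ] :
          Fin 6 → ℝ) i) ω := fun ω => by
    simp [secondInc, Fin.sum_univ_six]
    ring
  simp_rw [h]
  exact hB.integral_sum_pow_four _ _

theorem integral_secondInc_mul (hB : IsTwoSidedFBM H B) (hH : 0 < H) {δ : ℝ} (hδ : 0 < δ)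
    (j k : ℕ) :
    ∫ ω, secondInc (fun t => B t ω) δ j * secondInc (fun t => B t ω) δ k
      = δ ^ (2 * H) * secondIncCorr H (j - k) := by
  simp_rw [secondInc_eq_sum]
  rw [hB.integral_sum_mul_sum hH]
  have hs : ∀ x : ℝ, |x * δ| ^ (2 * H) = |x| ^ (2 * H) * δ ^ (2 * H) := fun x => by
    rw [abs_mul, abs_of_pos hδ, Real.mul_rpow (abs_nonneg x) hδ.le]
  simp only [Fin.sum_univ_three, fbmCov, secondIncCorr, Matrix.cons_val, ← sub_mul, hs]
  rw [show (j : ℝ) - 1 - (k - 1) = j - k by ring, show (j : ℝ) - 2 - (k - 2) = j - k by ring,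
    show (j : ℝ) - (k - 1) = j - k + 1 by ring, show (j : ℝ) - (k - 2) = j - k + 2 by ring,
    show (j : ℝ) - 1 - k = j - k - 1 by ring, show (j : ℝ) - 2 - k = j - k - 2 by ring,
    show (j : ℝ) - 1 - (k - 2) = j - k + 1 by ring, show (j : ℝ) - 2 - (k - 1) = j - k - 1 by ring]
  ring

theorem integral_secondInc_sq_mul_sq [IsProbabilityMeasure (ℙ : Measure Ω)]
    (hB : IsTwoSidedFBM H B) (hH : 0 < H) {δ : ℝ} (hδ : 0 < δ) (j k : ℕ) :
    ∫ ω, secondInc (fun t => B t ω) δ j ^ 2 * secondInc (fun t => B t ω) δ k ^ 2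
      = (δ ^ (2 * H)) ^ 2 * (secondIncCorr H 0 ^ 2 + 2 * secondIncCorr H (j - k) ^ 2) := by
  have h2 : ∀ k, ∫ ω, secondInc (fun t => B t ω) δ k ^ 2 = δ ^ (2 * H) * secondIncCorr H 0 :=
    fun k => by simpa [sq] using hB.integral_secondInc_mul hH hδ k k
  rw [integral_sq_mul_sq_of_gaussian (hB.memLp_secondInc δ j 4) (hB.memLp_secondInc δ k 4)
    (hB.integral_secondInc_pow_four δ j) (hB.integral_secondInc_pow_four δ k)
    (by simpa using hB.integral_add_secondInc_pow_four δ 1 j k)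
    (by simpa [← sub_eq_add_neg] using hB.integral_add_secondInc_pow_four δ (-1) j k),
    h2, h2, hB.integral_secondInc_mul hH hδ]
  ring

/-- Second moment of the centered quadratic variation of the second-order increments. -/
theorem integral_sum_secondInc_sq_sub [IsProbabilityMeasure (ℙ : Measure Ω)]
    (hB : IsTwoSidedFBM H B) (hH : 0 < H) {δ : ℝ} (hδ : 0 < δ) (s : Finset ℕ) :
    Integrable (fun ω =>
        (∑ k ∈ s, (secondInc (fun t => B t ω) δ k ^ 2 / δ ^ (2 * H) - secondIncCorr H 0)) ^ 2) ∧
      ∫ ω, (∑ k ∈ s, (secondInc (fun t => B t ω) δ k ^ 2 / δ ^ (2 * H) - secondIncCorr H 0)) ^ 2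
        = 2 * ∑ j ∈ s, ∑ k ∈ s, secondIncCorr H (j - k) ^ 2 := by
  have hd : δ ^ (2 * H) ≠ 0 := (Real.rpow_pos_of_pos hδ _).ne'
  have i22 : ∀ j k, Integrable fun ω =>
      secondInc (fun t => B t ω) δ j ^ 2 * secondInc (fun t => B t ω) δ k ^ 2 := fun j k =>
    (hB.memLp_secondInc δ j 4).integrable_sq_mul_sq (hB.memLp_secondInc δ k 4)
  have i2 : ∀ k, Integrable fun ω => secondInc (fun t => B t ω) δ k ^ 2 := fun k =>
    (hB.memLp_secondInc δ k 2).integrable_sq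
  have h2 : ∀ k, ∫ ω, secondInc (fun t => B t ω) δ k ^ 2 = δ ^ (2 * H) * secondIncCorr H 0 :=
    fun k => by simpa [sq] using hB.integral_secondInc_mul hH hδ k k
  have ex : ∀ j k ω,
      (secondInc (fun t => B t ω) δ j ^ 2 / δ ^ (2 * H) - secondIncCorr H 0)
        * (secondInc (fun t => B t ω) δ k ^ 2 / δ ^ (2 * H) - secondIncCorr H 0)
      = ((δ ^ (2 * H)) ^ 2)⁻¹
          * (secondInc (fun t => B t ω) δ j ^ 2 * secondInc (fun t => B t ω) δ k ^ 2)
        - (secondIncCorr H 0 / δ ^ (2 * H) * secondInc (fun t => B t ω) δ j ^ 2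
          + (secondIncCorr H 0 / δ ^ (2 * H) * secondInc (fun t => B t ω) δ k ^ 2
            - secondIncCorr H 0 ^ 2)) := fun j k ω => by
    field_simp
    ring
  have i1 : ∀ k, Integrable fun ω =>
      secondIncCorr H 0 / δ ^ (2 * H) * secondInc (fun t => B t ω) δ k ^ 2
        - secondIncCorr H 0 ^ 2 := fun k => ((i2 k).const_mul _).sub (integrable_const _)
  have i0 : ∀ j k, Integrable fun ω =>
      secondIncCorr H 0 / δ ^ (2 * H) * secondInc (fun t => B t ω) δ j ^ 2
        + (secondIncCorr H 0 / δ ^ (2 * H) * secondInc (fun t => B t ω) δ k ^ 2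
          - secondIncCorr H 0 ^ 2) := fun j k => ((i2 j).const_mul _).add (i1 k)
  have ii : ∀ j k, Integrable fun ω =>
      (secondInc (fun t => B t ω) δ j ^ 2 / δ ^ (2 * H) - secondIncCorr H 0)
        * (secondInc (fun t => B t ω) δ k ^ 2 / δ ^ (2 * H) - secondIncCorr H 0) := fun j k => by
    simp_rw [ex]
    exact ((i22 j k).const_mul _).sub (i0 j k)
  simp_rw [sq (∑ k ∈ s, _), Finset.sum_mul_sum]
  refine ⟨integrable_finsetSum _ fun i _ => integrable_finsetSum _ fun j _ => ii i j, ?_⟩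
  rw [integral_finsetSum _ fun i _ => integrable_finsetSum _ fun j _ => ii i j, Finset.mul_sum]
  refine Finset.sum_congr rfl fun j _ => ?_
  rw [integral_finsetSum _ fun k _ => ii j k, Finset.mul_sum]
  refine Finset.sum_congr rfl fun k _ => ?_
  simp_rw [ex]
  rw [integral_sub ((i22 j k).const_mul _) (i0 j k), integral_add ((i2 j).const_mul _) (i1 k),
    integral_sub ((i2 k).const_mul _) (integrable_const _)]
  simp only [integral_const_mul, h2, hB.integral_secondInc_sq_mul_sq hH hδ, integral_const]
  simp
  field_simp
  ring

end IsTwoSidedFBM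

/-- The second differences of `x ↦ x ^ p` tend to zero at infinity when `p < 2`. -/
theorem tendsto_secondDiff_rpow {p : ℝ} (hp : p < 2) :
    Tendsto (fun x : ℝ => (x + 1) ^ p - 2 * x ^ p + (x - 1) ^ p) atTop (𝓝 0) := by
  have hd : ∀ q y : ℝ, 0 < y → HasDerivAt (fun x : ℝ => x ^ q) (q * y ^ (q - 1)) y :=
    fun q y hy => Real.hasDerivAt_rpow_const (Or.inl hy.ne')
  have key : ∀ x : ℝ, 2 < x →
      |(x + 1) ^ p - 2 * x ^ p + (x - 1) ^ p| ≤ |p * (p - 1)| * (x - 1) ^ (p - 2) := by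
    intro x hx
    have dg : ∀ y : ℝ, 0 < y → HasDerivAt (fun y : ℝ => (y + 1) ^ p - y ^ p)
        (p * (y + 1) ^ (p - 1) - p * y ^ (p - 1)) y := fun y hy => by
      simpa using ((hd p (y + 1) (by linarith)).comp_add_const y 1).fun_sub (hd p y hy)
    obtain ⟨a, ha, ea⟩ := exists_hasDerivAt_eq_slope (fun y : ℝ => (y + 1) ^ p - y ^ p)
      (fun y => p * (y + 1) ^ (p - 1) - p * y ^ (p - 1)) (show x - 1 < x by linarith)
      (fun y hy => (dg y (by linarith [hy.1])).continuousAt.continuousWithinAt)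
      (fun y hy => dg y (by linarith [hy.1]))
    obtain ⟨b, hb, eb⟩ := exists_hasDerivAt_eq_slope (fun y : ℝ => y ^ (p - 1))
      (fun y => (p - 1) * y ^ (p - 1 - 1)) (show a < a + 1 by linarith)
      (fun y hy => (hd _ y (by linarith [hy.1, ha.1])).continuousAt.continuousWithinAt)
      (fun y hy => hd _ y (by linarith [hy.1, ha.1]))
    have e : (x + 1) ^ p - 2 * x ^ p + (x - 1) ^ p = p * (p - 1) * b ^ (p - 2) := by
      simp only [sub_add_cancel, sub_sub_cancel, div_one, add_sub_cancel_left] at ea eb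
      rw [show p - 1 - 1 = p - 2 by ring] at eb
      linear_combination -ea - p * eb
    rw [e, abs_mul, abs_of_nonneg (Real.rpow_nonneg (by linarith [hb.1, ha.1]) _)]
    exact mul_le_mul_of_nonneg_left (Real.rpow_le_rpow_of_nonpos (by linarith)
      (by linarith [hb.1, ha.1]) (by linarith)) (abs_nonneg _)
  have h0 : Tendsto (fun x : ℝ => |p * (p - 1)| * (x - 1) ^ (p - 2)) atTop (𝓝 0) := by
    have h1 : Tendsto (fun x : ℝ => x ^ (-(2 - p))) atTop (𝓝 0) :=
      tendsto_rpow_neg_atTop (by linarith)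
    have h2 : Tendsto (fun x : ℝ => x - 1) atTop atTop :=
      tendsto_atTop_add_const_right _ (-1) tendsto_id
    simpa using (h1.comp h2).const_mul |p * (p - 1)|
  refine squeeze_zero_norm' ?_ h0
  filter_upwards [eventually_gt_atTop 2] with x hx
  exact key x hx

theorem tendsto_secondIncCorr {H : ℝ} (hH : H < 1) :
    Tendsto (secondIncCorr H) atTop (𝓝 0) := by
  have h := tendsto_secondDiff_rpow (p := 2 * H) (by linarith)
  have hs : ∀ c : ℝ, Tendsto (fun x : ℝ => x + c) atTop atTop :=
    fun c => tendsto_atTop_add_const_right _ c tendsto_id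
  have h3 := (((h.comp (hs 1)).sub (h.const_mul 2)).add (h.comp (hs (-1)))).const_mul (-(1 / 2))
  simp only [mul_zero, sub_zero, add_zero] at h3
  refine h3.congr' ?_
  filter_upwards [eventually_gt_atTop 2] with x hx
  simp only [Function.comp, secondIncCorr]
  rw [abs_of_pos (by linarith : 0 < x + 2), abs_of_pos (by linarith : 0 < x + 1),
    abs_of_pos (by linarith : 0 < x), abs_of_pos (by linarith : 0 < x - 1),
    abs_of_pos (by linarith : 0 < x - 2), show x + 1 + 1 = x + 2 by ring,
    show x + -1 - 1 = x - 2 by ring, add_sub_cancel_right, ← sub_eq_add_neg, sub_add_cancel]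
  ring

theorem sum_sum_le_of_even {f : ℝ → ℝ} (hf : ∀ x, f (-x) = f x) (h0 : ∀ x, 0 ≤ f x) (a M : ℕ) :
    ∑ j ∈ Finset.Icc a M, ∑ k ∈ Finset.Icc a M, f ((j : ℝ) - k)
      ≤ 2 * (M + 1) * ∑ m ∈ Finset.range (M + 1), f m := by
  have h1 : ∀ j ∈ Finset.Icc a M, ∑ k ∈ Finset.Icc a M, f ((j : ℝ) - k)
      ≤ 2 * ∑ m ∈ Finset.range (M + 1), f m := by
    intro j hj
    rw [← Finset.sum_filter_add_sum_filter_not _ (fun k => k ≤ j), two_mul]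
    have hj' := (Finset.mem_Icc.1 hj).2
    gcongr
    · calc ∑ k ∈ Finset.Icc a M with k ≤ j, f ((j : ℝ) - k)
          = ∑ k ∈ Finset.Icc a M with k ≤ j, f ((j - k : ℕ) : ℝ) := by
            refine Finset.sum_congr rfl fun k hk => ?_
            rw [Nat.cast_sub (Finset.mem_filter.1 hk).2]
        _ = ∑ m ∈ ({k ∈ Finset.Icc a M | k ≤ j}).image (fun k => j - k), f m := by
            rw [Finset.sum_image]
            intro x hx y hy hxy
            have := (Finset.mem_filter.1 hx).2
            have := (Finset.mem_filter.1 hy).2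
            simp only at hxy
            omega
        _ ≤ _ := by
            refine Finset.sum_le_sum_of_subset_of_nonneg ?_ fun _ _ _ => h0 _
            intro m hm
            obtain ⟨k, hk, rfl⟩ := Finset.mem_image.1 hm
            simp only [Finset.mem_range]
            omega
    · calc ∑ k ∈ Finset.Icc a M with ¬ k ≤ j, f ((j : ℝ) - k)
          = ∑ k ∈ Finset.Icc a M with ¬ k ≤ j, f ((k - j : ℕ) : ℝ) := by
            refine Finset.sum_congr rfl fun k hk => ?_
            rw [Nat.cast_sub (not_le.1 (Finset.mem_filter.1 hk).2).le, ← hf, neg_sub]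
        _ = ∑ m ∈ ({k ∈ Finset.Icc a M | ¬ k ≤ j}).image (fun k => k - j), f m := by
            rw [Finset.sum_image]
            intro x hx y hy hxy
            have := (Finset.mem_filter.1 hx).2
            have := (Finset.mem_filter.1 hy).2
            simp only at hxy
            omega
        _ ≤ _ := by
            refine Finset.sum_le_sum_of_subset_of_nonneg ?_ fun _ _ _ => h0 _
            intro m hm
            obtain ⟨k, hk, rfl⟩ := Finset.mem_image.1 hm
            have := (Finset.mem_Icc.1 (Finset.mem_filter.1 hk).1).2
            simp only [Finset.mem_range]
            omega
  refine (Finset.sum_le_card_nsmul _ _ _ h1).trans ?_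
  rw [nsmul_eq_mul, Nat.card_Icc]
  have hS : 0 ≤ ∑ m ∈ Finset.range (M + 1), f m := Finset.sum_nonneg fun _ _ => h0 _
  have hc : ((M + 1 - a : ℕ) : ℝ) ≤ M + 1 := by
    exact_mod_cast Nat.sub_le (M + 1) a
  nlinarith

theorem tendsto_sum_secondIncCorr_sq {H : ℝ} (hH : H < 1) :
    Tendsto (fun M : ℕ => (∑ j ∈ Finset.Icc 2 M, ∑ k ∈ Finset.Icc 2 M,
      secondIncCorr H ((j : ℝ) - k) ^ 2) / (M : ℝ) ^ 2) atTop (𝓝 0) := by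
  have h1 : Tendsto (fun m : ℕ => secondIncCorr H m ^ 2) atTop (𝓝 0) := by
    simpa using ((tendsto_secondIncCorr hH).comp tendsto_natCast_atTop_atTop).pow 2
  have h2 := ((h1.cesaro).comp (tendsto_add_atTop_nat 1)).const_mul 8
  rw [mul_zero] at h2
  refine squeeze_zero' (Eventually.of_forall fun M => by positivity) ?_ h2
  filter_upwards [eventually_ge_atTop 1] with M hM
  have hM' : (1 : ℝ) ≤ M := by exact_mod_cast hM
  have h3 := sum_sum_le_of_even (f := fun x => secondIncCorr H x ^ 2)
    (fun x => by rw [secondIncCorr_neg]) (fun x => sq_nonneg _) 2 M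
  have hS : 0 ≤ ∑ m ∈ Finset.range (M + 1), secondIncCorr H m ^ 2 :=
    Finset.sum_nonneg fun _ _ => sq_nonneg _
  simp only [Function.comp]
  rw [div_le_iff₀ (by positivity)]
  refine h3.trans ?_
  push_cast
  have h4 : 2 * ((M : ℝ) + 1) ≤ 8 * ((M : ℝ) + 1)⁻¹ * (M : ℝ) ^ 2 := by
    rw [mul_comm (8 : ℝ), mul_assoc, inv_mul_eq_div, le_div_iff₀ (by positivity)]
    nlinarith
  calc _ ≤ 8 * ((M : ℝ) + 1)⁻¹ * (M : ℝ) ^ 2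
        * ∑ m ∈ Finset.range (M + 1), secondIncCorr H m ^ 2 :=
        mul_le_mul_of_nonneg_right h4 hS
    _ = _ := by ring

/-- Exponentially weighted average of the past of a path, with time scale `ε`. -/
def expAvg (ε : ℝ) (f : ℝ → ℝ) (t : ℝ) : ℝ :=
  (1 / ε) * ∫ s in Set.Iic t, Real.exp (-(t - s) / ε) * f s

section ExpAvg

variable {ε : ℝ} {f : ℝ → ℝ}

theorem integrableOn_exp_mul_of_abs (hf : Continuous f) {t : ℝ}
    (hi : IntegrableOn (fun s => Real.exp (-(t - s) / ε) * |f s|) (Set.Iic t)) :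
    IntegrableOn (fun s => Real.exp (-(t - s) / ε) * f s) (Set.Iic t) := by
  refine hi.mono' (Continuous.aestronglyMeasurable (by fun_prop)) (ae_of_all _ fun s => ?_)
  rw [norm_mul, Real.norm_eq_abs, Real.norm_eq_abs, abs_of_pos (Real.exp_pos _)]

theorem exp_neg_sub_div (t s : ℝ) :
    Real.exp (-(t - s) / ε) = Real.exp (-t / ε) * Real.exp (s / ε) := by
  rw [← Real.exp_add]; congr 1; ring

theorem hasDerivAt_expAvg (hf : Continuous f)
    (hi : ∀ t, IntegrableOn (fun s => Real.exp (-(t - s) / ε) * f s) (Set.Iic t)) (t : ℝ) :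
    HasDerivAt (expAvg ε f) ((1 / ε) * (f t - expAvg ε f t)) t := by
  have hj : ∀ t, IntegrableOn (fun s => Real.exp (s / ε) * f s) (Set.Iic t) := fun t => by
    refine ((hi t).const_mul (Real.exp (t / ε))).congr (ae_of_all _ fun s => ?_)
    simp only
    rw [exp_neg_sub_div, ← mul_assoc, ← mul_assoc, ← Real.exp_add]
    simp [neg_div]
  have hZ : expAvg ε f = fun t => (1 / ε) * (Real.exp (-t / ε)
      * ((∫ s in Set.Iic 0, Real.exp (s / ε) * f s) + ∫ s in (0 : ℝ)..t, Real.exp (s / ε) * f s)) := by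
    funext t
    rw [← intervalIntegral.integral_Iic_sub_Iic (hj 0) (hj t), add_sub_cancel,
      ← integral_const_mul]
    simp only [expAvg, exp_neg_sub_div, mul_assoc]
  have hc : Continuous fun s => Real.exp (s / ε) * f s := by fun_prop
  have h1 : HasDerivAt (fun t => ∫ s in (0 : ℝ)..t, Real.exp (s / ε) * f s)
      (Real.exp (t / ε) * f t) t :=
    intervalIntegral.integral_hasDerivAt_right (hc.intervalIntegrable _ _)
      (hc.stronglyMeasurableAtFilter _ _) hc.continuousAt
  have h2 : HasDerivAt (fun t => Real.exp (-t / ε)) (Real.exp (-t / ε) * (-1 / ε)) t :=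
    ((hasDerivAt_id t).neg.div_const ε).exp
  have h3 := (h2.fun_mul (h1.const_add (∫ s in Set.Iic 0, Real.exp (s / ε) * f s))).const_mul (1 / ε)
  rw [hZ]
  refine h3.congr_deriv ?_
  have h4 : Real.exp (-t / ε) * Real.exp (t / ε) = 1 := by
    rw [← Real.exp_add]; simp [neg_div]
  linear_combination (1 / ε) * f t * h4

theorem intervalIntegral_sub_expAvg (hε : 0 < ε) (hf : Continuous f)
    (hi : ∀ t, IntegrableOn (fun s => Real.exp (-(t - s) / ε) * f s) (Set.Iic t)) (t : ℝ) :
    ∫ s in (0 : ℝ)..t, (f s - expAvg ε f s) = ε * (expAvg ε f t - expAvg ε f 0) := by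
  have hd := hasDerivAt_expAvg hf hi
  have hc : Continuous (expAvg ε f) :=
    continuous_iff_continuousAt.2 fun t => (hd t).continuousAt
  have h := intervalIntegral.integral_eq_sub_of_hasDerivAt (a := 0) (b := t) (fun s _ => hd s)
    ((continuous_const.mul (hf.sub hc)).intervalIntegrable _ _)
  rw [← h, intervalIntegral.integral_const_mul]
  field_simp

theorem setIntegral_Iic_exp_neg_sub_div {a : ℝ} (ha : 0 < a) (t : ℝ) :
    IntegrableOn (fun s => Real.exp (-(t - s) / a)) (Set.Iic t) ∧
      ∫ s in Set.Iic t, Real.exp (-(t - s) / a) = a := by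
  have e : ∀ s : ℝ, Real.exp (-(t - s) / a) = Real.exp (-t / a) * Real.exp (a⁻¹ * s) := fun s => by
    rw [exp_neg_sub_div, inv_mul_eq_div]
  simp_rw [e]
  refine ⟨(integrableOn_exp_mul_Iic (inv_pos.2 ha) t).const_mul _, ?_⟩
  rw [integral_const_mul, integral_exp_mul_Iic (inv_pos.2 ha), ← mul_div_assoc, ← Real.exp_add]
  simp [neg_div, inv_mul_eq_div]

theorem lintegral_Iic_exp_neg_sub_div {a : ℝ} (ha : 0 < a) (t : ℝ) :
    ∫⁻ s in Set.Iic t, ENNReal.ofReal (Real.exp (-(t - s) / a)) = ENNReal.ofReal a := by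
  obtain ⟨h1, h2⟩ := setIntegral_Iic_exp_neg_sub_div ha t
  rw [← ofReal_integral_eq_lintegral_ofReal h1 (ae_of_all _ fun s => (Real.exp_pos _).le), h2]

/-- Cauchy–Schwarz inequality for a weighted lower Lebesgue integral. -/
theorem sq_lintegral_mul_le {α : Type*} {mα : MeasurableSpace α} {μ : Measure α}
    {w g : α → ENNReal} (hw : Measurable w) (hg : Measurable g) :
    (∫⁻ x, w x * g x ∂μ) ^ 2 ≤ (∫⁻ x, w x ∂μ) * ∫⁻ x, w x * g x ^ 2 ∂μ := by
  have h := ENNReal.lintegral_mul_le_Lp_mul_Lq (μ.withDensity w) Real.HolderConjugate.two_two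
    hg.aemeasurable (aemeasurable_const (b := (1 : ENNReal)))
  have e1 : ∫⁻ x, g x ∂(μ.withDensity w) = ∫⁻ x, w x * g x ∂μ := by
    rw [lintegral_withDensity_eq_lintegral_mul _ hw hg]; rfl
  have e2 : ∫⁻ x, g x ^ 2 ∂(μ.withDensity w) = ∫⁻ x, w x * g x ^ 2 ∂μ := by
    rw [lintegral_withDensity_eq_lintegral_mul _ hw (hg.pow_const 2)]; rfl
  have e3 : (μ.withDensity w) Set.univ = ∫⁻ x, w x ∂μ := by simp
  simp only [Pi.mul_apply, mul_one, ENNReal.rpow_two, one_pow, lintegral_const, one_mul, e1, e2,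
    e3] at h
  calc _ ≤ ((∫⁻ x, w x * g x ^ 2 ∂μ) ^ (1 / 2 : ℝ) * (∫⁻ x, w x ∂μ) ^ (1 / 2 : ℝ)) ^ 2 := by gcongr
    _ = _ := by
      rw [mul_pow, ← ENNReal.rpow_two, ← ENNReal.rpow_two, ← ENNReal.rpow_mul,
        ← ENNReal.rpow_mul, mul_comm]
      norm_num

theorem enorm_expAvg_sub_sq_le (hε : 0 < ε) (hf : Continuous f) (t : ℝ)
    (hi : IntegrableOn (fun s => Real.exp (-(t - s) / ε) * f s) (Set.Iic t)) :
    ‖expAvg ε f t - f t‖ₑ ^ 2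
      ≤ ∫⁻ s in Set.Iic t, ENNReal.ofReal (Real.exp (-(t - s) / ε) / ε) * ‖f s - f t‖ₑ ^ 2 := by
  obtain ⟨i1, e1⟩ := setIntegral_Iic_exp_neg_sub_div hε t
  have eD : expAvg ε f t - f t
      = ∫ s in Set.Iic t, Real.exp (-(t - s) / ε) / ε * (f s - f t) := by
    have : ∀ s, Real.exp (-(t - s) / ε) / ε * (f s - f t)
        = (1 / ε) * (Real.exp (-(t - s) / ε) * f s) - f t / ε * Real.exp (-(t - s) / ε) :=
      fun s => by ring
    simp_rw [this]
    rw [integral_sub (hi.const_mul _) (i1.const_mul _), integral_const_mul, integral_const_mul, e1,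
      div_mul_cancel₀ _ hε.ne', expAvg]
  have w1 : ∫⁻ s in Set.Iic t, ENNReal.ofReal (Real.exp (-(t - s) / ε) / ε) = 1 := by
    simp_rw [div_eq_mul_inv (Real.exp _) ε, ENNReal.ofReal_mul (Real.exp_pos _).le]
    rw [lintegral_mul_const _ (by fun_prop), lintegral_Iic_exp_neg_sub_div hε,
      ← ENNReal.ofReal_mul hε.le, mul_inv_cancel₀ hε.ne', ENNReal.ofReal_one]
  have h1 : ‖expAvg ε f t - f t‖ₑ
      ≤ ∫⁻ s in Set.Iic t, ENNReal.ofReal (Real.exp (-(t - s) / ε) / ε) * ‖f s - f t‖ₑ := by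
    rw [eD]
    refine (enorm_integral_le_lintegral_enorm _).trans_eq (lintegral_congr fun s => ?_)
    rw [enorm_mul, Real.enorm_of_nonneg (by positivity)]
  calc _ ≤ (∫⁻ s in Set.Iic t,
        ENNReal.ofReal (Real.exp (-(t - s) / ε) / ε) * ‖f s - f t‖ₑ) ^ 2 := by gcongr
    _ ≤ _ := sq_lintegral_mul_le (by fun_prop) (by fun_prop)
    _ = _ := by rw [w1, one_mul]

theorem rpow_le_nine_mul_exp_half {p y : ℝ} (hp0 : 0 ≤ p) (hp : p ≤ 2) (hy : 0 ≤ y) :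
    y ^ p ≤ 9 * Real.exp (y / 2) := by
  have h1 := Real.quadratic_le_exp_of_nonneg (x := y / 2) (by positivity)
  have h2 : y ^ p ≤ 1 + y ^ 2 := by
    rcases le_total y 1 with h | h
    · have := Real.rpow_le_one hy h hp0
      nlinarith
    · have := Real.rpow_le_rpow_of_exponent_le h hp
      rw [Real.rpow_two] at this
      linarith
  nlinarith

theorem lintegral_exp_mul_abs_rpow_le (hε : 0 < ε) {p : ℝ} (hp0 : 0 ≤ p) (hp : p ≤ 2) (t : ℝ) :
    ∫⁻ s in Set.Iic t, ENNReal.ofReal (Real.exp (-(t - s) / ε) / ε)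
        * ENNReal.ofReal (|s - t| ^ p) ≤ ENNReal.ofReal (18 * ε ^ p) := by
  calc _ ≤ ∫⁻ s in Set.Iic t, ENNReal.ofReal (9 * ε ^ p / ε)
        * ENNReal.ofReal (Real.exp (-(t - s) / (2 * ε))) := by
        refine setLIntegral_mono (by fun_prop) fun s hs => ?_
        rw [← ENNReal.ofReal_mul (by positivity), ← ENNReal.ofReal_mul (by positivity)]
        refine ENNReal.ofReal_le_ofReal ?_
        have hs' : 0 ≤ t - s := sub_nonneg.2 hs
        have h1 := rpow_le_nine_mul_exp_half hp0 hp (div_nonneg hs' hε.le)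
        have e1 : |s - t| ^ p = ε ^ p * ((t - s) / ε) ^ p := by
          rw [← Real.mul_rpow hε.le (div_nonneg hs' hε.le), abs_sub_comm, abs_of_nonneg hs',
            mul_div_cancel₀ _ hε.ne']
        have e2 : Real.exp (-(t - s) / (2 * ε))
            = Real.exp (-(t - s) / ε) * Real.exp ((t - s) / ε / 2) := by
          rw [← Real.exp_add]; congr 1; field_simp; ring
        rw [e1, e2]
        calc _ ≤ Real.exp (-(t - s) / ε) / ε * (ε ^ p * (9 * Real.exp ((t - s) / ε / 2))) := by
              gcongr
          _ = _ := by ring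
    _ = _ := by
        rw [lintegral_const_mul _ (by fun_prop), lintegral_Iic_exp_neg_sub_div (by positivity),
          ← ENNReal.ofReal_mul (by positivity)]
        congr 1
        field_simp
        norm_num

end ExpAvg

section SlowComponent

variable {Ω : Type*} [MeasureSpace Ω] {H σ ε : ℝ} {B : ℝ → Ω → ℝ}

theorem slowX_eq_expAvg_sub (hε : 0 < ε) {ω : Ω} (hf : Continuous fun t => B t ω)
    (hi : ∀ t : ℝ, IntegrableOn (fun s => Real.exp (-(t - s) / ε) * B s ω) (Set.Iic t)) (t : ℝ) :
    slowX H σ ε B t ω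
      = σ * (expAvg ε (fun t => B t ω) t - expAvg ε (fun t => B t ω) 0) := by
  have h := intervalIntegral_sub_expAvg hε hf hi t
  have e : ∀ s, fracOU H σ ε B s ω = (σ / ε ^ H) * (B s ω - expAvg ε (fun t => B t ω) s) :=
    fun s => rfl
  simp only [slowX, e]
  rw [intervalIntegral.integral_const_mul, h, Real.rpow_sub_one hε.ne']
  have : ε ^ H ≠ 0 := (Real.rpow_pos_of_pos hε _).ne'
  field_simp

theorem secondInc_slowX_sub (hσ : 0 < σ) (hε : 0 < ε) {ω : Ω} (hf : Continuous fun t => B t ω)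
    (hi : ∀ t : ℝ, IntegrableOn (fun s => Real.exp (-(t - s) / ε) * B s ω) (Set.Iic t))
    (δ : ℝ) (k : ℕ) :
    secondInc (fun t => slowX H σ ε B t ω) δ k / σ - secondInc (fun t => B t ω) δ k
      = secondInc (fun t => expAvg ε (fun t => B t ω) t - B t ω) δ k := by
  simp only [secondInc, slowX_eq_expAvg_sub hε hf hi]
  field_simp
  ring

theorem enorm_secondInc_sq_le (g : ℝ → ℝ) (δ : ℝ) (k : ℕ) :
    ‖secondInc g δ k‖ₑ ^ 2 ≤ 6 * (‖g (k * δ)‖ₑ ^ 2 + ‖g ((k - 1) * δ)‖ₑ ^ 2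
      + ‖g ((k - 2) * δ)‖ₑ ^ 2) := by
  have e : ∀ x : ℝ, ‖x‖ₑ ^ 2 = ENNReal.ofReal (x ^ 2) := fun x => by
    rw [← enorm_pow, Real.enorm_of_nonneg (sq_nonneg x)]
  simp only [e]
  rw [← ENNReal.ofReal_add (sq_nonneg _) (sq_nonneg _),
    ← ENNReal.ofReal_add (by positivity) (sq_nonneg _),
    show (6 : ENNReal) = ENNReal.ofReal 6 by simp, ← ENNReal.ofReal_mul (by norm_num)]
  refine ENNReal.ofReal_le_ofReal ?_
  simp only [secondInc]
  generalize g (k * δ) = a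
  generalize g ((k - 1) * δ) = b
  generalize g ((k - 2) * δ) = c
  nlinarith [sq_nonneg (2 * a + b), sq_nonneg (a - c), sq_nonneg (b + 2 * c)]

/-- An everywhere continuous and jointly measurable version of a two-sided fractional Brownian
motion. -/
theorem IsTwoSidedFBM.exists_continuous_version (hB : IsTwoSidedFBM H B) :
    ∃ B' : ℝ → Ω → ℝ, (∀ ω, Continuous fun t => B' t ω) ∧
      Measurable (Function.uncurry B') ∧ ∀ᵐ ω : Ω, ∀ t, B' t ω = B t ω := by
  obtain ⟨s, hs, hsm, hs0⟩ := exists_measurable_superset_of_null (ae_iff.1 hB.cont)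
  have hc : ∀ ω, Continuous fun t => sᶜ.indicator (B t) ω := fun ω => by
    by_cases h : ω ∈ s
    · simpa [h] using continuous_const
    · simp only [Set.indicator_of_mem (Set.mem_compl h)]
      by_contra hn
      exact h (hs hn)
  refine ⟨fun t => sᶜ.indicator (B t), hc, ?_, ?_⟩
  · exact measurable_uncurry_of_continuous_of_measurable hc fun t =>
      (hB.meas t).indicator hsm.compl
  · filter_upwards [compl_mem_ae_iff.2 hs0] with ω hω t
    exact Set.indicator_of_mem hω _

theorem exists_bound_expAvg_sub [IsProbabilityMeasure (ℙ : Measure Ω)] (hH : H ∈ Set.Ioo (0 : ℝ) 1)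
    (hε : 0 < ε) (hB : IsTwoSidedFBM H B)
    (hInt : ∀ᵐ ω : Ω, ∀ t : ℝ,
      IntegrableOn (fun s => Real.exp (-(t - s) / ε) * |B s ω|) (Set.Iic t)) :
    ∃ E : ℝ → Ω → ENNReal, (∀ t, Measurable (E t)) ∧
      (∀ t, ∫⁻ ω, E t ω ≤ ENNReal.ofReal (18 * ε ^ (2 * H))) ∧
      ∀ᵐ ω : Ω, ∀ t, ‖expAvg ε (fun t => B t ω) t - B t ω‖ₑ ^ 2 ≤ E t ω := by
  obtain ⟨B', hc, hm, he⟩ := hB.exists_continuous_version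
  have hmt : ∀ t, Measurable fun p : ℝ × Ω => B' t p.2 := fun t =>
    hm.comp (measurable_const.prodMk measurable_snd)
  have hj : ∀ t, Measurable fun p : ℝ × Ω =>
      ENNReal.ofReal (Real.exp (-(t - p.1) / ε) / ε) * ‖B' p.1 p.2 - B' t p.2‖ₑ ^ 2 := fun t =>
    Measurable.mul (by fun_prop) ((hm.sub (hmt t)).enorm.pow_const 2)
  refine ⟨fun t ω => ∫⁻ s in Set.Iic t,
    ENNReal.ofReal (Real.exp (-(t - s) / ε) / ε) * ‖B' s ω - B' t ω‖ₑ ^ 2, fun t => ?_,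
    fun t => ?_, ?_⟩
  · exact (hj t).lintegral_prod_left'
  · rw [lintegral_lintegral_swap (f := fun ω s =>
      ENNReal.ofReal (Real.exp (-(t - s) / ε) / ε) * ‖B' s ω - B' t ω‖ₑ ^ 2)
      ((hj t).comp measurable_swap).aemeasurable]
    refine le_trans (le_of_eq (lintegral_congr fun s => ?_))
      (lintegral_exp_mul_abs_rpow_le hε (p := 2 * H) (by linarith [hH.1]) (by linarith [hH.2]) t)
    have h1 : Integrable (fun ω => (B s ω - B t ω) ^ 2) :=
      MemLp.integrable_sq ((hB.memLp s 2).sub (hB.memLp t 2))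
    have hms : ∀ s, Measurable (B' s) := fun s => hm.comp measurable_prodMk_left
    rw [lintegral_const_mul _ (by fun_prop), ← hB.integral_sub_sq hH.1,
      ofReal_integral_eq_lintegral_ofReal h1 (ae_of_all _ fun _ => sq_nonneg _)]
    congr 1
    refine lintegral_congr_ae ?_
    filter_upwards [he] with ω hω
    rw [hω, hω, ← enorm_pow, Real.enorm_of_nonneg (sq_nonneg _)]
  · filter_upwards [he, hB.cont, hInt] with ω hω hcω hi t
    simp only [hω]
    exact enorm_expAvg_sub_sq_le hε hcω t (integrableOn_exp_mul_of_abs hcω (hi t))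

theorem measure_sum_secondInc_slowX_sub_sq_ge_le [IsProbabilityMeasure (ℙ : Measure Ω)]
    (hH : H ∈ Set.Ioo (0 : ℝ) 1) (hσ : 0 < σ) (hε : 0 < ε) (hB : IsTwoSidedFBM H B)
    (hInt : ∀ᵐ ω : Ω, ∀ t : ℝ,
      IntegrableOn (fun s => Real.exp (-(t - s) / ε) * |B s ω|) (Set.Iic t))
    (δ : ℝ) (s : Finset ℕ) {r : ℝ} (hr : 0 < r) :
    (ℙ : Measure Ω) {ω | r ≤ ∑ k ∈ s, (secondInc (fun t => slowX H σ ε B t ω) δ k / σ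
      - secondInc (fun t => B t ω) δ k) ^ 2} ≤ ENNReal.ofReal (324 * s.card * ε ^ (2 * H) / r) := by
  obtain ⟨E, hEm, hE, hae⟩ := exists_bound_expAvg_sub hH hε hB hInt
  set F : Ω → ENNReal := fun ω => ∑ k ∈ s,
    6 * (E (k * δ) ω + E ((k - 1) * δ) ω + E ((k - 2) * δ) ω) with hF
  have hFm : Measurable F := by fun_prop
  have hFi : ∫⁻ ω, F ω ≤ ENNReal.ofReal (324 * s.card * ε ^ (2 * H)) := by
    rw [hF, lintegral_finsetSum _ fun k _ => by fun_prop]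
    calc _ ≤ ∑ k ∈ s, ENNReal.ofReal (324 * ε ^ (2 * H)) := by
          refine Finset.sum_le_sum fun k _ => ?_
          rw [lintegral_const_mul _ (by fun_prop), lintegral_add_left (by fun_prop),
            lintegral_add_left (by fun_prop)]
          calc _ ≤ 6 * (ENNReal.ofReal (18 * ε ^ (2 * H)) + ENNReal.ofReal (18 * ε ^ (2 * H))
                + ENNReal.ofReal (18 * ε ^ (2 * H))) := by
                gcongr <;> exact hE _
            _ = _ := by
                rw [← ENNReal.ofReal_add (by positivity) (by positivity),
                  ← ENNReal.ofReal_add (by positivity) (by positivity),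
                  show (6 : ENNReal) = ENNReal.ofReal 6 by simp,
                  ← ENNReal.ofReal_mul (by norm_num)]
                congr 1; ring
      _ = _ := by
          rw [Finset.sum_const, ← ENNReal.ofReal_nsmul, nsmul_eq_mul]
          congr 1; ring
  calc _ ≤ (ℙ : Measure Ω) {ω | ENNReal.ofReal r ≤ F ω} := by
        refine measure_mono_ae ?_
        filter_upwards [hae, hB.cont, hInt] with ω h1 hc hi h
        refine (ENNReal.ofReal_le_ofReal h).trans ?_
        rw [ENNReal.ofReal_sum_of_nonneg fun _ _ => sq_nonneg _]
        refine Finset.sum_le_sum fun k _ => ?_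
        rw [← Real.enorm_of_nonneg (sq_nonneg _), enorm_pow,
          secondInc_slowX_sub hσ hε hc fun t => integrableOn_exp_mul_of_abs hc (hi t)]
        refine (enorm_secondInc_sq_le _ δ k).trans ?_
        gcongr <;> exact h1 _
    _ ≤ (∫⁻ ω, F ω) / ENNReal.ofReal r :=
        meas_ge_le_lintegral_div hFm.aemeasurable (by simpa using hr) ENNReal.ofReal_ne_top
    _ ≤ _ := by
        rw [ENNReal.ofReal_div_of_pos hr]
        gcongr

theorem measure_abs_sum_secondInc_sq_sub_ge_le [IsProbabilityMeasure (ℙ : Measure Ω)] (hH : 0 < H)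
    (hB : IsTwoSidedFBM H B) {δ : ℝ} (hδ : 0 < δ) (s : Finset ℕ) {r : ℝ} (hr : 0 < r) :
    (ℙ : Measure Ω) {ω | r ≤ |∑ k ∈ s, (secondInc (fun t => B t ω) δ k ^ 2 / δ ^ (2 * H)
        - secondIncCorr H 0)|}
      ≤ ENNReal.ofReal (2 * (∑ j ∈ s, ∑ k ∈ s, secondIncCorr H ((j : ℝ) - k) ^ 2) / r ^ 2) := by
  obtain ⟨h1, h2⟩ := hB.integral_sum_secondInc_sq_sub hH hδ s
  rw [ENNReal.ofReal_div_of_pos (by positivity), ← h2,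
    ofReal_integral_eq_lintegral_ofReal h1 (ae_of_all _ fun _ => sq_nonneg _)]
  refine le_trans (measure_mono fun ω hω => ?_) (meas_ge_le_lintegral_div
    h1.1.aemeasurable.ennreal_ofReal (by simpa using hr.ne') ENNReal.ofReal_ne_top)
  refine ENNReal.ofReal_le_ofReal ?_
  rw [← sq_abs (∑ k ∈ s, _)]
  exact pow_le_pow_left₀ hr.le hω 2

end SlowComponent

theorem abs_sum_add_sq_sub_le {ι : Type*} (s : Finset ι) (b e : ι → ℝ) {η : ℝ} (hη : 0 < η) :
    |∑ k ∈ s, (b k + e k) ^ 2 - ∑ k ∈ s, b k ^ 2|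
      ≤ η * ∑ k ∈ s, b k ^ 2 + (1 + 1 / η) * ∑ k ∈ s, e k ^ 2 := by
  rw [← Finset.sum_sub_distrib, Finset.mul_sum, Finset.mul_sum, ← Finset.sum_add_distrib]
  refine (Finset.abs_sum_le_sum_abs _ _).trans (Finset.sum_le_sum fun k _ => ?_)
  have h1 : 0 ≤ (η * b k - e k) ^ 2 / η := by positivity
  have h2 : 0 ≤ (η * b k + e k) ^ 2 / η := by positivity
  have e1 : (η * b k - e k) ^ 2 / η = η * b k ^ 2 - 2 * (b k * e k) + 1 / η * e k ^ 2 := by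
    field_simp; ring
  have e2 : (η * b k + e k) ^ 2 / η = η * b k ^ 2 + 2 * (b k * e k) + 1 / η * e k ^ 2 := by
    field_simp; ring
  rw [abs_le]
  constructor <;> nlinarith [sq_nonneg (e k)]

theorem abs_sum_sq_div_sub_lt {s : Finset ℕ} {x b : ℕ → ℝ} {σ V M c r r₁ r₂ η : ℝ}
    (hV : 0 < V) (hM : 0 < M) (hc : 0 < c) (hη : 0 < η) (hcard : (s.card : ℝ) ≤ M)
    (hcard' : c * (M - s.card) ≤ r / 8 * M)
    (hr₁ : r₁ ≤ 1) (hr₁' : r₁ ≤ r / 8) (hη' : η * (1 + c) ≤ r / 4)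
    (hr₂ : (1 + 1 / η) * r₂ ≤ r / 4) (hr : 0 < r)
    (hb : |∑ k ∈ s, (b k ^ 2 / V - c)| < r₁ * M)
    (he : ∑ k ∈ s, (x k / σ - b k) ^ 2 < r₂ * M * V) :
    |(∑ k ∈ s, x k ^ 2) / (σ ^ 2 * (M * V)) - c| < r := by
  set Q := ∑ k ∈ s, (b k ^ 2 / V - c) with hQ
  have hMV : 0 < M * V := mul_pos hM hV
  have hSb : ∑ k ∈ s, b k ^ 2 = V * (Q + c * s.card) := by
    rw [hQ, Finset.sum_sub_distrib, ← Finset.sum_div, Finset.sum_const, nsmul_eq_mul]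
    field_simp
    ring
  have h1 := abs_sum_add_sq_sub_le s b (fun k => x k / σ - b k) hη
  simp only [add_sub_cancel] at h1
  have hSx : (∑ k ∈ s, x k ^ 2) / (σ ^ 2 * (M * V)) = (∑ k ∈ s, (x k / σ) ^ 2) / (M * V) := by
    simp_rw [div_pow]
    rw [← Finset.sum_div, div_div]
  obtain ⟨hb1, hb2⟩ := abs_lt.1 hb
  have hb3 : ∑ k ∈ s, b k ^ 2 ≤ (1 + c) * (M * V) := by
    rw [hSb]
    nlinarith [mul_le_mul_of_nonneg_left hcard hc.le]
  have h2 : |∑ k ∈ s, (x k / σ) ^ 2 - ∑ k ∈ s, b k ^ 2| ≤ r / 2 * (M * V) := by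
    refine h1.trans ?_
    have h3 : η * ∑ k ∈ s, b k ^ 2 ≤ r / 4 * (M * V) :=
      (mul_le_mul_of_nonneg_left hb3 hη.le).trans (by nlinarith)
    have h4 : (1 + 1 / η) * ∑ k ∈ s, (x k / σ - b k) ^ 2 ≤ r / 4 * (M * V) := by
      refine (mul_le_mul_of_nonneg_left he.le (by positivity)).trans ?_
      nlinarith
    linarith
  obtain ⟨h2a, h2b⟩ := abs_le.1 h2
  have h5 : |∑ k ∈ s, b k ^ 2 - c * (M * V)| ≤ r / 4 * (M * V) := by
    have h6 : ∑ k ∈ s, b k ^ 2 - c * (M * V) = (Q - c * (M - s.card)) * V := by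
      rw [hSb]; ring
    have h7 : 0 ≤ c * (M - s.card) := mul_nonneg hc.le (sub_nonneg.2 hcard)
    rw [h6, abs_mul, abs_of_pos hV, ← mul_assoc]
    refine mul_le_mul_of_nonneg_right (abs_le.2 ⟨?_, ?_⟩) hV.le <;> nlinarith
  obtain ⟨h5a, h5b⟩ := abs_le.1 h5
  rw [hSx, div_sub' hMV.ne', abs_div, abs_of_pos hMV, div_lt_iff₀ hMV, abs_lt]
  have := mul_pos hr hMV
  constructor <;> linarith

theorem secondIncCorr_zero_pos {H : ℝ} (hH : H ∈ Set.Ioo (0 : ℝ) 1) : 0 < secondIncCorr H 0 := by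
  rw [secondIncCorr_zero hH.1, sub_pos]
  calc (2 : ℝ) ^ (2 * H) < 2 ^ (2 : ℝ) :=
        Real.rpow_lt_rpow_of_exponent_lt (by norm_num) (by linarith [hH.2])
    _ = 4 := by norm_num

/-- The normalized quadratic variation of the second-order increments of the slow component
converges in probability. -/
theorem tendsto_measure_sum_secondInc_slowX
    {Ω : Type*} [MeasureSpace Ω] [IsProbabilityMeasure (ℙ : Measure Ω)]
    {H σ : ℝ} (hH : H ∈ Set.Ioo (0 : ℝ) 1) (hσ : 0 < σ)
    {B : ℝ → Ω → ℝ} (hB : IsTwoSidedFBM H B)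
    (hInt : ∀ ε : ℝ, 0 < ε → ∀ᵐ ω : Ω, ∀ t : ℝ,
      IntegrableOn (fun s => Real.exp (-(t - s) / ε) * |B s ω|) (Set.Iic t))
    {εs δs : ℕ → ℝ} {Ms : ℕ → ℕ} (hε : ∀ n, 0 < εs n) (hδ : ∀ n, 0 < δs n)
    (hratio : Tendsto (fun n => εs n / δs n) atTop (𝓝 0)) (hMs : Tendsto Ms atTop atTop)
    {r : ℝ} (hr : 0 < r) :
    Tendsto (fun n => (ℙ : Measure Ω) {ω | r ≤ |(∑ k ∈ Finset.Icc 2 (Ms n),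
        (secondInc (fun t => slowX H σ (εs n) B t ω) (δs n) k) ^ 2)
          / (σ ^ 2 * (Ms n * δs n ^ (2 * H))) - secondIncCorr H 0|}) atTop (𝓝 0) := by
  have hc := secondIncCorr_zero_pos hH
  set c := secondIncCorr H 0
  set η := r / (4 * (1 + c)) with hη
  have hη0 : 0 < η := by positivity
  set r₁ := min 1 (r / 8)
  have hr₁ : 0 < r₁ := lt_min one_pos (by positivity)
  set r₂ := r / 4 / (1 + 1 / η) with hr₂
  have hr₂0 : 0 < r₂ := by positivity
  have l1 : Tendsto (fun n => ENNReal.ofReal (2 / r₁ ^ 2 * ((∑ j ∈ Finset.Icc 2 (Ms n),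
      ∑ k ∈ Finset.Icc 2 (Ms n), secondIncCorr H ((j : ℝ) - k) ^ 2) / (Ms n : ℝ) ^ 2)))
      atTop (𝓝 0) := by
    have := ((tendsto_sum_secondIncCorr_sq hH.2).comp hMs).const_mul (2 / r₁ ^ 2)
    rw [mul_zero] at this
    simpa using! ENNReal.tendsto_ofReal this
  have l2 : Tendsto (fun n => ENNReal.ofReal (324 / r₂ * (εs n / δs n) ^ (2 * H)))
      atTop (𝓝 0) := by
    have h2H : 0 < 2 * H := by linarith [hH.1]
    have := (hratio.rpow_const (p := 2 * H) (Or.inr h2H.le)).const_mul (324 / r₂)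
    rw [Real.zero_rpow h2H.ne', mul_zero] at this
    simpa using! ENNReal.tendsto_ofReal this
  have l3 := l1.add l2
  rw [add_zero] at l3
  refine tendsto_of_tendsto_of_tendsto_of_le_of_le' tendsto_const_nhds l3
    (Eventually.of_forall fun _ => zero_le) ?_
  have hMr : Tendsto (fun n => (Ms n : ℝ)) atTop atTop := tendsto_natCast_atTop_atTop.comp hMs
  filter_upwards [hMs.eventually_ge_atTop 1, hMr.eventually_ge_atTop (8 * c / r)] with n hn hn'
  have hM : (0 : ℝ) < Ms n := by exact_mod_cast hn
  have hV : 0 < δs n ^ (2 * H) := Real.rpow_pos_of_pos (hδ n) _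
  have hcard : ((Finset.Icc 2 (Ms n)).card : ℝ) = Ms n - 1 := by
    rw [Nat.card_Icc, show Ms n + 1 - 2 = Ms n - 1 by omega, Nat.cast_sub hn, Nat.cast_one]
  have hsub : {ω | r ≤ |(∑ k ∈ Finset.Icc 2 (Ms n),
        (secondInc (fun t => slowX H σ (εs n) B t ω) (δs n) k) ^ 2)
          / (σ ^ 2 * (Ms n * δs n ^ (2 * H))) - c|}
      ⊆ {ω | r₁ * Ms n ≤ |∑ k ∈ Finset.Icc 2 (Ms n),
          (secondInc (fun t => B t ω) (δs n) k ^ 2 / δs n ^ (2 * H) - c)|}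
        ∪ {ω | r₂ * Ms n * δs n ^ (2 * H) ≤ ∑ k ∈ Finset.Icc 2 (Ms n),
          (secondInc (fun t => slowX H σ (εs n) B t ω) (δs n) k / σ
            - secondInc (fun t => B t ω) (δs n) k) ^ 2} := by
    intro ω hω
    by_contra hcon
    simp only [Set.mem_union, Set.mem_ofPred_eq, not_or, not_le] at hcon hω
    refine absurd (abs_sum_sq_div_sub_lt hV hM hc hη0 (by linarith) ?_ (min_le_left _ _)
      (min_le_right _ _) ?_ ?_ hr hcon.1 hcon.2) (not_lt.2 hω)
    · rw [hcard]
      rw [div_le_iff₀ hr] at hn'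
      linarith
    · rw [hη]
      apply le_of_eq
      field_simp
    · rw [hr₂]
      apply le_of_eq
      field_simp
  refine (measure_mono hsub).trans ((measure_union_le _ _).trans (add_le_add ?_ ?_))
  · refine (measure_abs_sum_secondInc_sq_sub_ge_le hH.1 hB (hδ n) _ (by positivity)).trans
      (ENNReal.ofReal_le_ofReal (le_of_eq ?_))
    field_simp
  · refine (measure_sum_secondInc_slowX_sub_sq_ge_le hH hσ (hε n) hB (hInt _ (hε n)) (δs n) _
      (by positivity)).trans (ENNReal.ofReal_le_ofReal ?_)
    rw [Real.div_rpow (hε n).le (hδ n).le, hcard]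
    have hE : 0 < εs n ^ (2 * H) := Real.rpow_pos_of_pos (hε n) _
    calc _ ≤ 324 * (Ms n : ℝ) * εs n ^ (2 * H) / (r₂ * Ms n * δs n ^ (2 * H)) := by
          gcongr
          linarith
      _ = _ := by field_simp

theorem hurstHat_sub_eq {Ω : Type*} [MeasureSpace Ω] {H σ ε δ : ℝ} (hσ : 0 < σ) (hδ : 0 < δ)
    {B : ℝ → Ω → ℝ} {N : ℕ} (hN : 0 < N) {ω : Ω} {x y : ℝ} (hx : 0 < x) (hy : 0 < y)
    (ex : (∑ k ∈ Finset.Icc 2 (2 * N), (secondInc (fun t => slowX H σ ε B t ω) (δ / 2) k) ^ 2)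
      / (σ ^ 2 * ((2 * N : ℕ) * (δ / 2) ^ (2 * H))) = x)
    (ey : (∑ k ∈ Finset.Icc 2 N, (secondInc (fun t => slowX H σ ε B t ω) δ k) ^ 2)
      / (σ ^ 2 * (N * δ ^ (2 * H))) = y) :
    hurstHat H σ ε δ B N ω - H = -(1 / (2 * Real.log 2)) * Real.log (x / y) := by
  have hN' : (0 : ℝ) < N := by exact_mod_cast hN
  have hV : 0 < δ ^ (2 * H) := Real.rpow_pos_of_pos hδ _
  have h2V : (0 : ℝ) < 2 ^ (2 * H) := Real.rpow_pos_of_pos two_pos _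
  have hl : 0 < Real.log 2 := Real.log_pos one_lt_two
  rw [div_eq_iff (by positivity)] at ey
  rw [Real.div_rpow hδ.le zero_le_two, div_eq_iff (by positivity)] at ex
  unfold hurstHat
  rw [ex, ey]
  have e : x * (σ ^ 2 * (((2 * N : ℕ) : ℝ) * (δ ^ (2 * H) / 2 ^ (2 * H))))
      / (y * (σ ^ 2 * (N * δ ^ (2 * H)))) = x / y * (2 / 2 ^ (2 * H)) := by
    push_cast
    field_simp
  rw [e, Real.log_mul (by positivity) (by positivity), Real.log_div two_ne_zero h2V.ne',
    Real.log_rpow two_pos]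
  field_simp
  ring


/-- Consistency in probability of the Hurst-parameter estimator
under `δ(ε) → 0` and `ε/δ(ε) → 0`. -/
theorem hurstHat_consistent
    {Ω : Type*} [MeasureSpace Ω] [IsProbabilityMeasure (ℙ : Measure Ω)]
    (H σ T : ℝ) (hH : H ∈ Set.Ioo (0 : ℝ) 1) (hσ : 0 < σ) (hT : 0 < T)
    (B : ℝ → Ω → ℝ) (hB : IsTwoSidedFBM H B)
    (hInt : ∀ ε : ℝ, 0 < ε → ∀ᵐ ω : Ω, ∀ t : ℝ,
      IntegrableOn (fun s => Real.exp (-(t - s) / ε) * |B s ω|) (Set.Iic t))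
    (εs δs : ℕ → ℝ) (Ns : ℕ → ℕ)
    (hεpos : ∀ n, 0 < εs n) (hδpos : ∀ n, 0 < δs n)
    (hδ0 : Tendsto δs atTop (𝓝 0))
    (hratio : Tendsto (fun n => εs n / δs n) atTop (𝓝 0))
    (hNpos : ∀ n, 0 < Ns n) (hNs : ∀ n, (Ns n : ℝ) = T / δs n) :
    ∀ ξ : ℝ, 0 < ξ →
      Tendsto
        (fun n => (ℙ : Measure Ω) {ω | ξ < |hurstHat H σ (εs n) (δs n) B (Ns n) ω - H|})
        atTop (𝓝 0) := by
  intro ξ hξ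
  have hc := secondIncCorr_zero_pos hH
  have hN : Tendsto Ns atTop atTop := by
    have h1 : Tendsto (fun n => (δs n)⁻¹) atTop atTop :=
      (tendsto_nhdsWithin_iff.2 ⟨hδ0, Eventually.of_forall hδpos⟩).inv_tendsto_nhdsGT_zero
    rw [← tendsto_natCast_atTop_iff (R := ℝ)]
    simp_rw [hNs, div_eq_mul_inv]
    exact h1.const_mul_atTop hT
  have hg : ContinuousAt (fun p : ℝ × ℝ => -(1 / (2 * Real.log 2)) * Real.log (p.1 / p.2))
      (secondIncCorr H 0, secondIncCorr H 0) := by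
    refine continuousAt_const.mul ((continuousAt_fst.div continuousAt_snd hc.ne').log ?_)
    simp [hc.ne']
  obtain ⟨r₀, hr₀, hr⟩ := Metric.continuousAt_iff.1 hg ξ hξ
  have hr1 : 0 < min r₀ (secondIncCorr H 0) := lt_min hr₀ hc
  have hratio2 : Tendsto (fun n => εs n / (δs n / 2)) atTop (𝓝 0) := by
    have := hratio.const_mul 2
    rw [mul_zero] at this
    refine this.congr fun n => ?_
    field_simp
  have l1 := tendsto_measure_sum_secondInc_slowX hH hσ hB hInt hεpos
    (fun n => half_pos (hδpos n)) hratio2 (hN.const_mul_atTop' two_pos) hr1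
  have l2 := tendsto_measure_sum_secondInc_slowX hH hσ hB hInt hεpos hδpos hratio hN hr1
  have l3 := l1.add l2
  rw [add_zero] at l3
  refine tendsto_of_tendsto_of_tendsto_of_le_of_le tendsto_const_nhds l3
    (fun _ => zero_le) fun n => ?_
  refine (measure_mono fun ω hω => ?_).trans (measure_union_le _ _)
  by_contra hcon
  simp only [Set.mem_union, Set.mem_ofPred_eq, not_or, not_le] at hcon hω
  obtain ⟨h1, h2⟩ := hcon
  have h1' := (abs_lt.1 (h1.trans_le (min_le_right _ _))).1
  have h2' := (abs_lt.1 (h2.trans_le (min_le_right _ _))).1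
  rw [hurstHat_sub_eq hσ (hδpos n) (hNpos n) (by linarith) (by linarith) rfl rfl] at hω
  refine lt_asymm hω ?_
  have h3 := hr (x := (_, _)) (Prod.dist_eq.trans_lt (max_lt
    ((Real.dist_eq _ _).trans_lt (h1.trans_le (min_le_left _ _)))
    ((Real.dist_eq _ _).trans_lt (h2.trans_le (min_le_left _ _)))))
  simpa [Real.dist_eq, hc.ne'] using h3
end
end

section
/- Let H ∈ (0,1) and T > 0, and let β = max{1, 2H}. There exists a constant C > 0, depending only on H and T, such that for every N ∈ ℕ, with δ = T/N, the matrix Σ^H_{δ,N} is invertible and its inverse satisfies the spectral-norm bound ‖(Σ^H_{δ,N})⁻¹‖₂ ≤ C N^β; equivalently, for every u ∈ ℝ^N one has uᵀ Σ^H_{δ,N} u ≥ C⁻¹ N^{−β} Σ_{i=1}^{N} u_i². -/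
open MeasureTheory ProbabilityTheory Filter Matrix Topology

noncomputable section

/-- Covariance matrix of the increments, over a grid of mesh `δ`, of fractional Brownian
motion with Hurst parameter `H`. -/
def SigmaH (H δ : ℝ) (N : ℕ) : Matrix (Fin N) (Fin N) ℝ := fun i j =>
  δ ^ (2 * H) / 2 *
    (|(i : ℝ) - (j : ℝ) + 1| ^ (2 * H) + |(i : ℝ) - (j : ℝ) - 1| ^ (2 * H)
      - 2 * |(i : ℝ) - (j : ℝ)| ^ (2 * H))

/-- Spectral norm (operator norm induced by the Euclidean norm) of a matrix. -/
def specNorm (N : ℕ) (A : Matrix (Fin N) (Fin N) ℝ) : ℝ :=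
  ‖(Matrix.toEuclideanCLM (𝕜 := ℝ) A : EuclideanSpace ℝ (Fin N) →L[ℝ] EuclideanSpace ℝ (Fin N))‖

/-- Weight of the harmonic representation of fractional Gaussian noise. -/
def fgnWeight (H t : ℝ) : ℝ := (1 - Real.cos t) * t ^ (-1 - 2 * H)

lemma fgnWeight_nonneg (H : ℝ) {t : ℝ} (ht : 0 < t) : 0 ≤ fgnWeight H t :=
  mul_nonneg (by linarith [Real.cos_le_one t]) (Real.rpow_nonneg ht.le _)

lemma integrableOn_fgnWeight {H : ℝ} (hH : H ∈ Set.Ioo (0 : ℝ) 1) :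
    IntegrableOn (fgnWeight H) (Set.Ioi 0) := by
  have hmeas : Measurable (fgnWeight H) := by unfold fgnWeight; fun_prop
  rw [← Set.Ioc_union_Ioi_eq_Ioi (zero_le_one' ℝ)]
  refine IntegrableOn.union ?_ ?_
  · have h1 : IntegrableOn (fun t : ℝ => t ^ (1 - 2 * H)) (Set.Ioc 0 1) := by
      rw [← intervalIntegrable_iff_integrableOn_Ioc_of_le zero_le_one]
      exact intervalIntegral.intervalIntegrable_rpow' (by linarith [hH.2])
    refine Integrable.mono' h1 hmeas.aestronglyMeasurable ?_
    filter_upwards [ae_restrict_mem measurableSet_Ioc] with t ht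
    rw [Real.norm_of_nonneg (fgnWeight_nonneg H ht.1)]
    have h2 : t ^ (1 - 2 * H) = t ^ 2 * t ^ (-1 - 2 * H) := by
      rw [← Real.rpow_natCast, ← Real.rpow_add ht.1]; congr 1; push_cast; ring
    rw [h2, fgnWeight]
    refine mul_le_mul_of_nonneg_right ?_ (Real.rpow_nonneg ht.1.le _)
    nlinarith [Real.one_sub_sq_div_two_le_cos (x := t), sq_nonneg t]
  · have h1 : IntegrableOn (fun t : ℝ => 2 * t ^ (-1 - 2 * H)) (Set.Ioi 1) :=
      (integrableOn_Ioi_rpow_of_lt (by linarith [hH.1]) zero_lt_one).const_mul 2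
    refine Integrable.mono' h1 hmeas.aestronglyMeasurable ?_
    filter_upwards [ae_restrict_mem measurableSet_Ioi] with t ht
    have ht0 : 0 < t := zero_lt_one.trans ht
    rw [Real.norm_of_nonneg (fgnWeight_nonneg H ht0), fgnWeight]
    exact mul_le_mul_of_nonneg_right (by linarith [Real.neg_one_le_cos t])
      (Real.rpow_nonneg ht0.le _)

/-- Normalising constant of the harmonic representation. -/
def fgnConst (H : ℝ) : ℝ := ∫ t in Set.Ioi 0, fgnWeight H t

lemma fgnWeight_lower (H : ℝ) {t : ℝ} (ht : 0 < t) (htπ : t ≤ Real.pi) :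
    2 / Real.pi ^ 2 * t ^ (1 - 2 * H) ≤ fgnWeight H t := by
  have h2 : t ^ (1 - 2 * H) = t ^ 2 * t ^ (-1 - 2 * H) := by
    rw [← Real.rpow_natCast, ← Real.rpow_add ht]; congr 1; push_cast; ring
  rw [h2, fgnWeight, ← mul_assoc]
  refine mul_le_mul_of_nonneg_right ?_ (Real.rpow_nonneg ht.le _)
  linarith [Real.cos_le_one_sub_mul_cos_sq (x := t) (by rwa [abs_of_pos ht])]

lemma fgnConst_pos {H : ℝ} (hH : H ∈ Set.Ioo (0 : ℝ) 1) : 0 < fgnConst H := by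
  rw [fgnConst, setIntegral_pos_iff_support_of_nonneg_ae _ (integrableOn_fgnWeight hH)]
  · have hsub : Set.Ioc 0 Real.pi ⊆ Function.support (fgnWeight H) ∩ Set.Ioi 0 := by
      intro t ht
      refine ⟨ne_of_gt (lt_of_lt_of_le ?_ (fgnWeight_lower H ht.1 ht.2)), ht.1⟩
      have := Real.rpow_pos_of_pos ht.1 (1 - 2 * H)
      positivity
    refine lt_of_lt_of_le ?_ (measure_mono hsub)
    simp [Real.pi_pos]
  · filter_upwards [ae_restrict_mem measurableSet_Ioi] with t ht
    exact fgnWeight_nonneg H ht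

lemma one_sub_cos_mul_eq (H : ℝ) {x t : ℝ} (hx : 0 < x) (ht : 0 < t) :
    (1 - Real.cos (x * t)) * t ^ (-1 - 2 * H) = x ^ (1 + 2 * H) * fgnWeight H (x * t) := by
  rw [fgnWeight, Real.mul_rpow hx.le ht.le]
  have : x ^ (1 + 2 * H) * x ^ (-1 - 2 * H) = 1 := by
    rw [← Real.rpow_add hx]; ring_nf; simp
  linear_combination (-(1 - Real.cos (x * t)) * t ^ (-1 - 2 * H)) * this

lemma integrableOn_one_sub_cos_mul {H : ℝ} (hH : H ∈ Set.Ioo (0 : ℝ) 1) (x : ℝ) :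
    IntegrableOn (fun t => (1 - Real.cos (x * t)) * t ^ (-1 - 2 * H)) (Set.Ioi 0) := by
  wlog hx : 0 ≤ x generalizing x
  · simpa using this (-x) (by linarith)
  rcases hx.eq_or_lt with rfl | hx
  · simp
  refine IntegrableOn.congr_fun (f := fun t => x ^ (1 + 2 * H) * fgnWeight H (x * t)) ?_
    (fun t ht => (one_sub_cos_mul_eq H hx ht).symm) measurableSet_Ioi
  refine Integrable.const_mul ?_ _
  have := (integrableOn_Ioi_comp_mul_left_iff (fgnWeight H) 0 hx).2
    (by simpa using integrableOn_fgnWeight hH)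
  exact this

lemma integral_one_sub_cos_mul {H : ℝ} (hH : H ∈ Set.Ioo (0 : ℝ) 1) (x : ℝ) :
    ∫ t in Set.Ioi 0, (1 - Real.cos (x * t)) * t ^ (-1 - 2 * H)
      = |x| ^ (2 * H) * fgnConst H := by
  wlog hx : 0 ≤ x generalizing x
  · simpa using this (-x) (by linarith)
  rcases hx.eq_or_lt with rfl | hx
  · simp [Real.zero_rpow (show 2 * H ≠ 0 by linarith [hH.1])]
  rw [setIntegral_congr_fun measurableSet_Ioi (fun t ht => one_sub_cos_mul_eq H hx ht),
    integral_const_mul, integral_comp_mul_left_Ioi _ _ hx, abs_of_pos hx, mul_zero, smul_eq_mul,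
    ← mul_assoc, fgnConst, add_comm, Real.rpow_add hx, Real.rpow_one, mul_assoc (x ^ (2 * H)),
    mul_inv_cancel₀ hx.ne', mul_one]

lemma cos_mul_fgnWeight (H x t : ℝ) :
    Real.cos (x * t) * fgnWeight H t =
      ((1 - Real.cos ((x + 1) * t)) * t ^ (-1 - 2 * H)
        + (1 - Real.cos ((x - 1) * t)) * t ^ (-1 - 2 * H)
        - 2 * ((1 - Real.cos (x * t)) * t ^ (-1 - 2 * H))) / 2 := by
  rw [add_mul x, sub_mul x, one_mul, Real.cos_add, Real.cos_sub, fgnWeight]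
  ring

lemma integrableOn_cos_mul_fgnWeight {H : ℝ} (hH : H ∈ Set.Ioo (0 : ℝ) 1) (x : ℝ) :
    IntegrableOn (fun t => Real.cos (x * t) * fgnWeight H t) (Set.Ioi 0) := by
  simp_rw [cos_mul_fgnWeight]
  exact (((integrableOn_one_sub_cos_mul hH _).add (integrableOn_one_sub_cos_mul hH _)).sub
    ((integrableOn_one_sub_cos_mul hH _).const_mul 2)).div_const 2

lemma integral_cos_mul_fgnWeight {H : ℝ} (hH : H ∈ Set.Ioo (0 : ℝ) 1) (x : ℝ) :
    ∫ t in Set.Ioi 0, Real.cos (x * t) * fgnWeight H t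
      = fgnConst H * ((|x + 1| ^ (2 * H) + |x - 1| ^ (2 * H) - 2 * |x| ^ (2 * H)) / 2) := by
  simp_rw [cos_mul_fgnWeight]
  rw [integral_div, integral_sub, integral_add, integral_const_mul,
    integral_one_sub_cos_mul hH, integral_one_sub_cos_mul hH, integral_one_sub_cos_mul hH]
  · ring
  · exact integrableOn_one_sub_cos_mul hH _
  · exact integrableOn_one_sub_cos_mul hH _
  · exact (integrableOn_one_sub_cos_mul hH _).add (integrableOn_one_sub_cos_mul hH _)
  · exact (integrableOn_one_sub_cos_mul hH _).const_mul 2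

/-- Squared modulus at frequency `t` of the trigonometric polynomial with coefficients `u`. -/
def periodogram {N : ℕ} (u : Fin N → ℝ) (t : ℝ) : ℝ :=
  (∑ i, u i * Real.cos (i * t)) ^ 2 + (∑ i, u i * Real.sin (i * t)) ^ 2

lemma periodogram_nonneg {N : ℕ} (u : Fin N → ℝ) (t : ℝ) : 0 ≤ periodogram u t := by
  unfold periodogram; positivity

lemma continuous_periodogram {N : ℕ} (u : Fin N → ℝ) : Continuous (periodogram u) := by
  unfold periodogram; fun_prop

lemma periodogram_eq_sum {N : ℕ} (u : Fin N → ℝ) (t : ℝ) :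
    periodogram u t = ∑ i, ∑ j, u i * u j * Real.cos (((i : ℝ) - (j : ℝ)) * t) := by
  rw [periodogram, sq, sq, Finset.sum_mul_sum, Finset.sum_mul_sum, ← Finset.sum_add_distrib]
  refine Finset.sum_congr rfl fun i _ => ?_
  rw [← Finset.sum_add_distrib]
  refine Finset.sum_congr rfl fun j _ => ?_
  rw [sub_mul, Real.cos_sub]
  ring

lemma periodogram_le {N : ℕ} (u : Fin N → ℝ) (t : ℝ) :
    periodogram u t ≤ N * ∑ i, u i ^ 2 := by
  have hc := sq_sum_le_card_mul_sum_sq (s := Finset.univ) (f := fun i => u i * Real.cos (i * t))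
  have hs := sq_sum_le_card_mul_sum_sq (s := Finset.univ) (f := fun i => u i * Real.sin (i * t))
  rw [Finset.card_univ, Fintype.card_fin] at hc hs
  refine (add_le_add hc hs).trans_eq ?_
  rw [← mul_add, ← Finset.sum_add_distrib]
  congr 1
  refine Finset.sum_congr rfl fun i _ => ?_
  linear_combination u i ^ 2 * Real.sin_sq_add_cos_sq (i * t)

lemma integral_periodogram {N : ℕ} (u : Fin N → ℝ) :
    ∫ t in (0 : ℝ)..Real.pi, periodogram u t = Real.pi * ∑ i, u i ^ 2 := by
  have hcos : ∀ i j : Fin N, ∫ t in (0 : ℝ)..Real.pi, Real.cos (((i : ℝ) - (j : ℝ)) * t)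
      = if i = j then Real.pi else 0 := by
    intro i j
    split_ifs with h
    · simp [h]
    · have hne : (i : ℝ) - (j : ℝ) ≠ 0 := by
        rw [sub_ne_zero]; exact_mod_cast fun h' => h (Fin.ext h')
      rw [intervalIntegral.integral_comp_mul_left (fun s => Real.cos s) hne, integral_cos]
      have := Real.sin_int_mul_pi ((i : ℤ) - (j : ℤ))
      push_cast at this
      simp [this]
  simp_rw [periodogram_eq_sum]
  rw [intervalIntegral.integral_finsetSum, Finset.mul_sum]
  · refine Finset.sum_congr rfl fun i _ => ?_
    rw [intervalIntegral.integral_finsetSum]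
    · simp_rw [intervalIntegral.integral_const_mul, hcos]
      simp
      ring
    · intro j _
      exact Continuous.intervalIntegrable (by fun_prop) _ _
  · intro i _
    exact Continuous.intervalIntegrable (by fun_prop) _ _

lemma fgnConst_mul_quadForm {H : ℝ} (hH : H ∈ Set.Ioo (0 : ℝ) 1) (δ : ℝ) {N : ℕ}
    (u : Fin N → ℝ) :
    fgnConst H * (u ⬝ᵥ (SigmaH H δ N *ᵥ u))
      = δ ^ (2 * H) * ∫ t in Set.Ioi 0, periodogram u t * fgnWeight H t := by
  have hint : ∀ i j : Fin N, IntegrableOn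
      (fun t => u i * u j * (Real.cos (((i : ℝ) - (j : ℝ)) * t) * fgnWeight H t)) (Set.Ioi 0) :=
    fun i j => (integrableOn_cos_mul_fgnWeight hH _).const_mul _
  simp_rw [periodogram_eq_sum, Finset.sum_mul, mul_assoc (_ * _) (Real.cos _)]
  rw [integral_finsetSum _ fun i _ => integrable_finsetSum _ fun j _ => hint i j]
  simp_rw [integral_finsetSum _ fun j _ => hint _ j, integral_const_mul,
    integral_cos_mul_fgnWeight hH, dotProduct, mulVec, dotProduct, Finset.mul_sum]
  refine Finset.sum_congr rfl fun i _ => Finset.sum_congr rfl fun j _ => ?_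
  rw [SigmaH]
  ring

lemma integrableOn_periodogram_mul_fgnWeight {H : ℝ} (hH : H ∈ Set.Ioo (0 : ℝ) 1) {N : ℕ}
    (u : Fin N → ℝ) :
    IntegrableOn (fun t => periodogram u t * fgnWeight H t) (Set.Ioi 0) := by
  simp_rw [periodogram_eq_sum, Finset.sum_mul, mul_assoc (_ * _) (Real.cos _)]
  exact integrable_finsetSum _ fun i _ => integrable_finsetSum _ fun j _ =>
    (integrableOn_cos_mul_fgnWeight hH _).const_mul _

lemma sum_sq_le_integral_periodogram {N : ℕ} (hN : 0 < N) (u : Fin N → ℝ) :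
    ∑ i, u i ^ 2 ≤ ∫ t in (1 / N : ℝ)..Real.pi, periodogram u t := by
  have hN' : (0 : ℝ) < N := by exact_mod_cast hN
  have hii : ∀ a b : ℝ, IntervalIntegrable (periodogram u) volume a b :=
    fun a b => (continuous_periodogram u).intervalIntegrable a b
  have hsplit := intervalIntegral.integral_add_adjacent_intervals
    (hii 0 (1 / N)) (hii (1 / N) Real.pi)
  have hlow : ∫ t in (0 : ℝ)..(1 / N), periodogram u t ≤ ∑ i, u i ^ 2 := by
    refine (intervalIntegral.integral_mono_on (by positivity) (hii _ _)
      intervalIntegrable_const fun t _ => periodogram_le u t).trans_eq ?_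
    rw [intervalIntegral.integral_const, smul_eq_mul]
    field_simp
    ring
  rw [integral_periodogram] at hsplit
  have hS : 0 ≤ ∑ i, u i ^ 2 := Finset.sum_nonneg fun i _ => sq_nonneg _
  nlinarith [Real.pi_gt_three]

lemma mul_sum_sq_le_quadForm {H : ℝ} (hH : H ∈ Set.Ioo (0 : ℝ) 1) {δ m : ℝ} (hδ : 0 ≤ δ)
    (hm : 0 ≤ m) {N : ℕ} (hN : 0 < N)
    (hw : ∀ t ∈ Set.Ioc (1 / N : ℝ) Real.pi, m ≤ fgnWeight H t) (u : Fin N → ℝ) :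
    δ ^ (2 * H) * m * ∑ i, u i ^ 2 ≤ fgnConst H * (u ⬝ᵥ (SigmaH H δ N *ᵥ u)) := by
  have hN1 : (1 : ℝ) ≤ N := by exact_mod_cast hN
  have hle : (1 / N : ℝ) ≤ Real.pi :=
    ((div_le_one (by linarith)).2 hN1).trans (by linarith [Real.pi_gt_three])
  have hsub : Set.Ioc (1 / N : ℝ) Real.pi ⊆ Set.Ioi 0 := fun t ht =>
    lt_trans (show (0 : ℝ) < 1 / N by positivity) ht.1
  rw [fgnConst_mul_quadForm hH, mul_assoc]
  refine mul_le_mul_of_nonneg_left ?_ (Real.rpow_nonneg hδ _)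
  calc m * ∑ i, u i ^ 2
      ≤ m * ∫ t in (1 / N : ℝ)..Real.pi, periodogram u t :=
        mul_le_mul_of_nonneg_left (sum_sq_le_integral_periodogram hN u) hm
    _ = ∫ t in Set.Ioc (1 / N : ℝ) Real.pi, periodogram u t * m := by
        rw [intervalIntegral.integral_of_le hle, integral_mul_const, mul_comm]
    _ ≤ ∫ t in Set.Ioc (1 / N : ℝ) Real.pi, periodogram u t * fgnWeight H t := by
        refine setIntegral_mono_on ?_ ((integrableOn_periodogram_mul_fgnWeight hH u).mono_set hsub)
          measurableSet_Ioc fun t ht =>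
            mul_le_mul_of_nonneg_left (hw t ht) (periodogram_nonneg u t)
        rw [← intervalIntegrable_iff_integrableOn_Ioc_of_le hle]
        exact ((continuous_periodogram u).mul continuous_const).intervalIntegrable _ _
    _ ≤ ∫ t in Set.Ioi 0, periodogram u t * fgnWeight H t := by
        refine setIntegral_mono_set (integrableOn_periodogram_mul_fgnWeight hH u) ?_
          hsub.eventuallyLE
        filter_upwards [ae_restrict_mem measurableSet_Ioi] with t ht
        exact mul_nonneg (periodogram_nonneg u t) (fgnWeight_nonneg H ht)

lemma exists_mul_rpow_le_rpow (H : ℝ) :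
    ∃ c > 0, ∀ N : ℕ, 0 < N → ∀ t ∈ Set.Ioc (1 / N : ℝ) Real.pi,
      c * (N : ℝ) ^ (2 * H - max 1 (2 * H)) ≤ t ^ (1 - 2 * H) := by
  rcases le_total 1 (2 * H) with h | h
  · refine ⟨Real.pi ^ (1 - 2 * H), Real.rpow_pos_of_pos Real.pi_pos _, fun N hN t ht => ?_⟩
    have ht0 : 0 < t := lt_trans (show (0 : ℝ) < 1 / N by positivity) ht.1
    rw [max_eq_right h, sub_self, Real.rpow_zero, mul_one]
    exact Real.rpow_le_rpow_of_nonpos ht0 ht.2 (by linarith)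
  · refine ⟨1, one_pos, fun N hN t ht => ?_⟩
    rw [max_eq_left h, one_mul, show 2 * H - 1 = -(1 - 2 * H) by ring,
      Real.rpow_neg (Nat.cast_nonneg N), ← Real.inv_rpow (Nat.cast_nonneg N), ← one_div]
    exact Real.rpow_le_rpow (by positivity) ht.1.le (by linarith)

lemma isUnit_of_coercive {N : ℕ} {A : Matrix (Fin N) (Fin N) ℝ} {a : ℝ} (ha : 0 < a)
    (hA : ∀ u : Fin N → ℝ, a * ∑ i, u i ^ 2 ≤ u ⬝ᵥ (A *ᵥ u)) : IsUnit A := by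
  rw [← Matrix.mulVec_injective_iff_isUnit, ← Matrix.coe_mulVecLin, ← LinearMap.ker_eq_bot,
    LinearMap.ker_eq_bot']
  intro u hu
  have h := hA u
  rw [← Matrix.mulVecLin_apply, hu, dotProduct_zero] at h
  have h0 : ∑ i, u i ^ 2 = 0 :=
    le_antisymm (nonpos_of_mul_nonpos_right h ha) (Finset.sum_nonneg fun i _ => sq_nonneg _)
  rw [Finset.sum_eq_zero_iff_of_nonneg fun i _ => sq_nonneg _] at h0
  exact funext fun i => pow_eq_zero_iff two_ne_zero |>.1 (h0 i (Finset.mem_univ i))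

lemma specNorm_inv_le_of_coercive {N : ℕ} {A : Matrix (Fin N) (Fin N) ℝ} {a : ℝ} (ha : 0 < a)
    (hA : ∀ u : Fin N → ℝ, a * ∑ i, u i ^ 2 ≤ u ⬝ᵥ (A *ᵥ u)) : specNorm N A⁻¹ ≤ a⁻¹ := by
  have hdet : IsUnit A.det := (Matrix.isUnit_iff_isUnit_det A).1 (isUnit_of_coercive ha hA)
  refine ContinuousLinearMap.opNorm_le_bound _ (inv_nonneg.2 ha.le) fun x => ?_
  set y := Matrix.toEuclideanCLM (𝕜 := ℝ) A⁻¹ x with hy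
  have hyx : A *ᵥ y.ofLp = x.ofLp := by
    rw [hy, Matrix.ofLp_toEuclideanCLM, Matrix.mulVec_mulVec, Matrix.mul_nonsing_inv _ hdet,
      Matrix.one_mulVec]
  have h := hA y.ofLp
  rw [hyx, ← EuclideanSpace.real_norm_sq_eq] at h
  have hin : y.ofLp ⬝ᵥ x.ofLp ≤ ‖y‖ * ‖x‖ := by
    refine le_trans (le_of_eq ?_) (real_inner_le_norm y x)
    rw [EuclideanSpace.inner_eq_star_dotProduct, star_trivial, dotProduct_comm]
  rw [inv_mul_eq_div, le_div_iff₀ ha]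
  rcases (norm_nonneg y).eq_or_lt with h0 | h0
  · rw [← h0, zero_mul]; exact norm_nonneg x
  · exact le_of_mul_le_mul_left (by nlinarith) h0

/-- Spectral bound on the inverse covariance matrix of fractional Gaussian noise:
`‖(Σ^H_{δ,N})⁻¹‖₂ ≤ C N^β` with `β = max{1, 2H}`, `δ = T/N`; equivalently,
`uᵀ Σ^H_{δ,N} u ≥ C⁻¹ N^{−β} Σᵢ uᵢ²` for every `u ∈ ℝ^N`. -/
theorem sigmaH_inv_specNorm_bound (H T : ℝ) (hH : H ∈ Set.Ioo (0 : ℝ) 1) (hT : 0 < T)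
    (β : ℝ) (hβ : β = max 1 (2 * H)) :
    ∃ C > 0, ∀ N : ℕ, 0 < N →
      IsUnit (SigmaH H (T / N) N) ∧
      specNorm N (SigmaH H (T / N) N)⁻¹ ≤ C * (N : ℝ) ^ β ∧
      ∀ u : Fin N → ℝ,
        C⁻¹ * (N : ℝ) ^ (-β) * ∑ i, (u i) ^ 2 ≤ u ⬝ᵥ (SigmaH H (T / N) N *ᵥ u) := by
  subst hβ
  obtain ⟨c, hc, hcN⟩ := exists_mul_rpow_le_rpow H
  have hK := fgnConst_pos hH
  set κ : ℝ := T ^ (2 * H) * (2 / Real.pi ^ 2 * c) / fgnConst H with hκ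
  have hκ0 : 0 < κ := by
    have := Real.rpow_pos_of_pos hT (2 * H)
    have := Real.pi_pos
    positivity
  refine ⟨κ⁻¹, inv_pos.2 hκ0, fun N hN => ?_⟩
  have hN' : (0 : ℝ) < N := by exact_mod_cast hN
  have hcoer : ∀ u : Fin N → ℝ, κ * (N : ℝ) ^ (-max 1 (2 * H)) * ∑ i, (u i) ^ 2
      ≤ u ⬝ᵥ (SigmaH H (T / N) N *ᵥ u) := by
    intro u
    have h := mul_sum_sq_le_quadForm hH (δ := T / N)
      (m := 2 / Real.pi ^ 2 * (c * (N : ℝ) ^ (2 * H - max 1 (2 * H))))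
      (by positivity) (by positivity) hN (fun t ht => ?_) u
    · rw [← mul_le_mul_iff_right₀ hK]
      refine le_trans (le_of_eq ?_) h
      rw [Real.div_rpow hT.le hN'.le, sub_eq_add_neg, Real.rpow_add hN', hκ]
      have := Real.rpow_pos_of_pos hN' (2 * H)
      field_simp
    · exact (mul_le_mul_of_nonneg_left (hcN N hN t ht) (by positivity)).trans
        (fgnWeight_lower H (lt_trans (by positivity) ht.1) ht.2)
  have ha : 0 < κ * (N : ℝ) ^ (-max 1 (2 * H)) :=
    mul_pos hκ0 (Real.rpow_pos_of_pos hN' _)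
  refine ⟨isUnit_of_coercive ha hcoer, ?_, by simpa using hcoer⟩
  refine (specNorm_inv_le_of_coercive ha hcoer).trans_eq ?_
  rw [mul_inv, Real.rpow_neg hN'.le, inv_inv]
end
end

section
/- Let γ ∈ (0,1/2). There exists a constant C > 0, depending only on γ, such that for every T > 0, every N ∈ ℕ with δ = T/N, and every u ∈ ℝ^N, the step function f = Σ_{i=0}^{N−1} u_{i+1} 1_{[iδ,(i+1)δ)} satisfies ∫_ℝ (D_−^γ f(t))² dt ≤ C δ^{1−2γ} Σ_{i=1}^{N} u_i². -/
open MeasureTheory Filter Topology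

noncomputable section

/-- Fractional integral `I_+^γ h(t) = (1/Γ(γ)) ∫_{−∞}^t (t−s)^{γ−1} h(s) ds`. -/
def fracIntPlus (γ : ℝ) (h : ℝ → ℝ) (t : ℝ) : ℝ :=
  (1 / Real.Gamma γ) * ∫ s in Set.Iio t, (t - s) ^ (γ - 1) * h s

/-- Marchaud fractional derivative
`D_−^γ h(t) = (γ/Γ(1−γ)) ∫_0^∞ (h(t) − h(t+s)) s^{−γ−1} ds`. -/
def marchaudDMinus (γ : ℝ) (h : ℝ → ℝ) (t : ℝ) : ℝ :=
  (γ / Real.Gamma (1 - γ)) * ∫ s in Set.Ioi (0 : ℝ), (h t - h (t + s)) * s ^ (-γ - 1)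

/-- The step function `f = Σ_{i=0}^{N−1} u_{i+1} 1_{[iδ,(i+1)δ)}` with `δ = T/N`. -/
def stepFun (T : ℝ) (N : ℕ) (u : Fin N → ℝ) (t : ℝ) : ℝ :=
  ∑ i : Fin N, (Set.Ico ((i : ℝ) * (T / N)) (((i : ℝ) + 1) * (T / N))).indicator
    (fun _ => u i) t

open Set
open scoped ENNReal

theorem Real.enorm_sq (x : ℝ) : ‖x‖ₑ ^ 2 = ENNReal.ofReal (x ^ 2) := by
  rw [Real.enorm_eq_ofReal_abs, ← ENNReal.ofReal_pow (abs_nonneg x), sq_abs]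

theorem Real.enorm_sub_sq_le (x y : ℝ) : ‖x - y‖ₑ ^ 2 ≤ 2 * ‖x‖ₑ ^ 2 + 2 * ‖y‖ₑ ^ 2 := by
  have h2 : (2 : ℝ≥0∞) = ENNReal.ofReal 2 := by simp
  rw [Real.enorm_sq, Real.enorm_sq, Real.enorm_sq, h2, ← ENNReal.ofReal_mul zero_le_two,
    ← ENNReal.ofReal_mul zero_le_two, ← ENNReal.ofReal_add (by positivity) (by positivity)]
  exact ENNReal.ofReal_le_ofReal (by nlinarith [sq_nonneg (x + y)])

theorem sq_lintegral_le {α : Type*} [MeasurableSpace α] (μ : Measure α) {f : α → ℝ≥0∞}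
    (hf : AEMeasurable f μ) : (∫⁻ a, f a ∂μ) ^ 2 ≤ μ univ * ∫⁻ a, f a ^ 2 ∂μ := by
  have h := ENNReal.lintegral_mul_le_Lp_mul_Lq μ Real.HolderConjugate.two_two hf
    (aemeasurable_const (b := (1 : ℝ≥0∞)))
  simp only [Pi.mul_apply, mul_one, ENNReal.rpow_two, one_pow, lintegral_const,
    one_mul] at h
  refine (pow_le_pow_left' h 2).trans_eq ?_
  rw [mul_pow, ← ENNReal.rpow_two, ← ENNReal.rpow_two, ← ENNReal.rpow_mul, ← ENNReal.rpow_mul]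
  norm_num [mul_comm]

theorem tsum_lintegral_le {α ι : Type*} [MeasurableSpace α] (μ : Measure α)
    (f : ι → α → ℝ≥0∞) : ∑' i, ∫⁻ a, f i a ∂μ ≤ ∫⁻ a, ∑' i, f i a ∂μ := by
  classical
  rw [ENNReal.tsum_eq_iSup_sum]
  refine iSup_le fun s => le_trans ?_ (lintegral_mono fun a => ENNReal.sum_le_tsum s)
  induction s using Finset.induction_on with
  | empty => simp
  | insert i s hi ih =>
    simp only [Finset.sum_insert hi]
    exact (add_le_add_right ih _).trans (le_lintegral_add _ _)

theorem lintegral_le_lintegral_Ico_tsum {δ : ℝ} (hδ : 0 < δ) (f : ℝ → ℝ≥0∞) :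
    ∫⁻ t, f t ≤ ∫⁻ x in Ico 0 δ, ∑' k : ℤ, f (x + k * δ) := by
  have hd : Pairwise (Function.onFun Disjoint fun n : ℤ => Ico (n • δ) ((n + 1) • δ)) :=
    pairwise_disjoint_Ico_zsmul δ
  rw [← setLIntegral_univ, ← iUnion_Ico_zsmul hδ,
    lintegral_iUnion (fun _ => measurableSet_Ico) hd]
  refine le_trans (le_of_eq (tsum_congr fun k => ?_)) (tsum_lintegral_le _ _)
  rw [← lintegral_indicator measurableSet_Ico, ← lintegral_indicator measurableSet_Ico,
    ← lintegral_add_right_eq_self _ (k * δ)]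
  congr 1 with x
  simp only [indicator, mem_Ico, zsmul_eq_mul, Int.cast_add, Int.cast_one, add_mul, one_mul]
  congr 1
  simp only [eq_iff_iff]
  constructor <;> rintro ⟨h1, h2⟩ <;> constructor <;> linarith

/-- The measure `s ^ (-γ - 1) ds` on `(r, ∞)`. -/
def tailMeasure (γ r : ℝ) : Measure ℝ :=
  (volume.restrict (Ioi r)).withDensity fun s => ENNReal.ofReal (s ^ (-γ - 1))

theorem tailMeasure_univ {γ r : ℝ} (hγ : 0 < γ) (hr : 0 < r) :
    tailMeasure γ r univ = ENNReal.ofReal (r ^ (-γ) / γ) := by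
  rw [tailMeasure, withDensity_apply _ MeasurableSet.univ, setLIntegral_univ,
    ← ofReal_integral_eq_lintegral_ofReal (integrableOn_Ioi_rpow_of_lt (by linarith) hr)
      ((ae_restrict_mem measurableSet_Ioi).mono fun s hs =>
        Real.rpow_nonneg (hr.le.trans (le_of_lt hs)) _),
    integral_Ioi_rpow_of_lt (by linarith) hr]
  congr 1
  rw [show -γ - 1 + 1 = -γ by ring, neg_div_neg_eq]

theorem enorm_setIntegral_mul_rpow_le {γ r : ℝ} {g : ℝ → ℝ} (hg : Measurable g)
    (hg0 : ∀ s ∈ Ioo 0 r, g s = 0) :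
    ‖∫ s in Ioi (0 : ℝ), g s * s ^ (-γ - 1)‖ₑ ≤ ∫⁻ s, ‖g s‖ₑ ∂tailMeasure γ r := by
  refine (enorm_integral_le_lintegral_enorm _).trans ?_
  rw [tailMeasure, lintegral_withDensity_eq_lintegral_mul _ (by fun_prop) (by fun_prop),
    setLIntegral_congr (Ioi_ae_eq_Ici (a := r)), ← lintegral_indicator measurableSet_Ioi,
    ← lintegral_indicator measurableSet_Ici]
  refine lintegral_mono fun s => ?_
  by_cases hs : s ∈ Ioi (0 : ℝ)
  · rw [indicator_of_mem hs]
    by_cases hsr : s ∈ Ici r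
    · rw [indicator_of_mem hsr, Pi.mul_apply, enorm_mul,
        Real.enorm_eq_ofReal (Real.rpow_nonneg (le_of_lt hs) _), mul_comm]
    · simp [hg0 s ⟨hs, not_le.1 hsr⟩]
  · simp [indicator_of_notMem hs]

/-- The squares of `∫ (f t - f (t + s)) s ^ (-γ - 1) ds` along a grid `t = x + k δ`, where
`f` is constant on the cells `[k δ, (k + 1) δ)`. -/
theorem tsum_enorm_sq_gridStep_le {γ δ x : ℝ} (hγ : 0 < γ) (hδ : 0 < δ) (hx : x ∈ Ico 0 δ)
    (v : ℤ → ℝ) :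
    ∑' k : ℤ, ‖∫ s in Ioi (0 : ℝ),
        (v ⌊(x + k * δ) / δ⌋ - v ⌊(x + k * δ + s) / δ⌋) * s ^ (-γ - 1)‖ₑ ^ 2
      ≤ ENNReal.ofReal ((δ - x) ^ (-γ) / γ) ^ 2 * (4 * ∑' k : ℤ, ‖v k‖ₑ ^ 2) := by
  have hr : 0 < δ - x := sub_pos.2 hx.2
  have hfl (k : ℤ) (s : ℝ) : ⌊(x + k * δ + s) / δ⌋ = ⌊(x + s) / δ⌋ + k := by
    rw [← Int.floor_add_intCast]
    congr 1
    field_simp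
    ring
  have hfl0 (s : ℝ) (hs : 0 ≤ s) (hs' : s < δ - x) : ⌊(x + s) / δ⌋ = 0 := by
    rw [Int.floor_eq_zero_iff, mem_Ico, div_lt_one hδ]
    exact ⟨div_nonneg (add_nonneg hx.1 hs) hδ.le, by linarith⟩
  have hflk (k : ℤ) : ⌊(x + k * δ) / δ⌋ = k := by
    have := hfl k 0
    rw [hfl0 0 le_rfl hr] at this
    simpa using this
  have hshift (m : ℤ) : ∑' k : ℤ, ‖v (m + k)‖ₑ ^ 2 = ∑' k : ℤ, ‖v k‖ₑ ^ 2 :=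
    (Equiv.addLeft m).tsum_eq fun k => ‖v k‖ₑ ^ 2
  have hv : Measurable v := measurable_from_top
  have hmeas (k : ℤ) : Measurable fun s : ℝ => v k - v (⌊(x + s) / δ⌋ + k) := by
    refine measurable_const.sub (hv.comp ?_)
    exact (Int.measurable_floor.comp (by fun_prop)).add_const k
  simp only [hfl, hflk]
  calc _ ≤ ∑' k : ℤ, tailMeasure γ (δ - x) univ *
        ∫⁻ s, (2 * ‖v k‖ₑ ^ 2 + 2 * ‖v (⌊(x + s) / δ⌋ + k)‖ₑ ^ 2) ∂tailMeasure γ (δ - x) := by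
        refine ENNReal.tsum_le_tsum fun k => ?_
        refine (pow_le_pow_left' (enorm_setIntegral_mul_rpow_le (r := δ - x) (hmeas k) ?_) 2).trans
          ((sq_lintegral_le _ (hmeas k).enorm.aemeasurable).trans ?_)
        · intro s hs
          rw [hfl0 s hs.1.le hs.2, zero_add, sub_self]
        · gcongr
          exact Real.enorm_sub_sq_le _ _
    _ ≤ tailMeasure γ (δ - x) univ *
        ∫⁻ s, ∑' k : ℤ, (2 * ‖v k‖ₑ ^ 2 + 2 * ‖v (⌊(x + s) / δ⌋ + k)‖ₑ ^ 2)
          ∂tailMeasure γ (δ - x) := by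
        rw [ENNReal.tsum_mul_left]
        gcongr
        exact tsum_lintegral_le _ _
    _ = _ := by
        simp only [ENNReal.tsum_add, ENNReal.tsum_mul_left, hshift, lintegral_const,
          tailMeasure_univ hγ hr]
        ring

theorem setLIntegral_ofReal_rpow_sq {γ δ : ℝ} (hγ0 : 0 < γ) (hγ : γ < 1 / 2) (hδ : 0 < δ) :
    ∫⁻ x in Ico 0 δ, ENNReal.ofReal ((δ - x) ^ (-γ) / γ) ^ 2
      = ENNReal.ofReal (δ ^ (1 - 2 * γ) / ((1 - 2 * γ) * γ ^ 2)) := by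
  have hI : IntervalIntegrable (fun x : ℝ => (δ - x) ^ (-(2 * γ)) / γ ^ 2) volume 0 δ := by
    have := (intervalIntegral.intervalIntegrable_rpow' (a := δ) (b := 0)
      (r := -(2 * γ)) (by linarith)).comp_sub_left δ
    simpa using this.div_const (γ ^ 2)
  have hcongr : ∫⁻ x in Ico 0 δ, ENNReal.ofReal ((δ - x) ^ (-γ) / γ) ^ 2
      = ∫⁻ x in Ico 0 δ, ENNReal.ofReal ((δ - x) ^ (-(2 * γ)) / γ ^ 2) := by
    refine setLIntegral_congr_fun measurableSet_Ico fun x hx => ?_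
    have hr : 0 < δ - x := sub_pos.2 hx.2
    rw [← ENNReal.ofReal_pow (by positivity), div_pow, ← Real.rpow_mul_natCast hr.le]
    congr 3
    push_cast
    ring
  rw [hcongr, setLIntegral_congr Ico_ae_eq_Ioc, ← ofReal_integral_eq_lintegral_ofReal
      ((intervalIntegrable_iff_integrableOn_Ioc_of_le hδ.le).1 hI)
      ((ae_restrict_mem measurableSet_Ioc).mono fun x hx =>
        div_nonneg (Real.rpow_nonneg (sub_nonneg.2 hx.2) _) (sq_nonneg γ)),
    ← intervalIntegral.integral_of_le hδ.le, intervalIntegral.integral_div,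
    intervalIntegral.integral_comp_sub_left (fun y => y ^ (-(2 * γ))) δ,
    integral_rpow (Or.inl (by linarith))]
  congr 1
  rw [show -(2 * γ) + 1 = 1 - 2 * γ by ring, sub_self, sub_zero,
    Real.zero_rpow (by linarith), sub_zero, div_div]

theorem stepFun_eq_floor {T : ℝ} (hT : 0 < T) {N : ℕ} (hN : 0 < N) (u : Fin N → ℝ) (t : ℝ) :
    stepFun T N u t = ∑ i : Fin N, if (i : ℤ) = ⌊t / (T / N)⌋ then u i else 0 := by
  have hδ : 0 < T / N := by positivity
  refine Finset.sum_congr rfl fun i _ => ?_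
  rw [indicator]
  congr 1
  rw [eq_comm (a := (i : ℤ)), Int.floor_eq_iff, mem_Ico, le_div_iff₀ hδ, div_lt_iff₀ hδ]
  simp

theorem tsum_enorm_sq_extend {N : ℕ} (u : Fin N → ℝ) :
    ∑' k : ℤ, ‖∑ i : Fin N, if (i : ℤ) = k then u i else 0‖ₑ ^ 2
      = ENNReal.ofReal (∑ i, u i ^ 2) := by
  have hinj : Function.Injective fun i : Fin N => (i : ℤ) := fun i j h => by
    simpa [Fin.ext_iff] using h
  rw [← hinj.tsum_eq, tsum_fintype, ENNReal.ofReal_sum_of_nonneg fun i _ => sq_nonneg _]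
  · refine Finset.sum_congr rfl fun i _ => ?_
    rw [← Real.enorm_sq]
    simp [← Fin.ext_iff]
  · intro k hk
    by_contra h
    refine hk ?_
    have h' (i : Fin N) : (i : ℤ) ≠ k := fun hi => h ⟨i, hi⟩
    simp [h']

theorem lintegral_marchaudDMinus_stepFun_le {γ : ℝ} (hγ : γ ∈ Ioo (0 : ℝ) (1 / 2)) {T : ℝ}
    (hT : 0 < T) {N : ℕ} (hN : 0 < N) (u : Fin N → ℝ) :
    ∫⁻ t, ‖marchaudDMinus γ (stepFun T N u) t‖ₑ ^ 2
      ≤ ENNReal.ofReal (4 * (γ / Real.Gamma (1 - γ)) ^ 2 / ((1 - 2 * γ) * γ ^ 2)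
          * (T / N) ^ (1 - 2 * γ) * ∑ i, u i ^ 2) := by
  have hδ : 0 < T / N := by positivity
  have hγ' : 0 < 1 - 2 * γ := by linarith [hγ.2]
  set v : ℤ → ℝ := fun k => ∑ i : Fin N, if (i : ℤ) = k then u i else 0 with hv
  set c := γ / Real.Gamma (1 - γ)
  have hD (t : ℝ) : ‖marchaudDMinus γ (stepFun T N u) t‖ₑ ^ 2 = ENNReal.ofReal (c ^ 2) *
      ‖∫ s in Ioi (0 : ℝ), (v ⌊t / (T / N)⌋ - v ⌊(t + s) / (T / N)⌋) * s ^ (-γ - 1)‖ₑ ^ 2 := by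
    simp only [marchaudDMinus, stepFun_eq_floor hT hN, hv, ← Real.enorm_sq, ← mul_pow,
      ← enorm_mul, c]
  simp only [hD]
  rw [lintegral_const_mul' _ _ ENNReal.ofReal_ne_top]
  calc _ ≤ ENNReal.ofReal (c ^ 2) * ∫⁻ x in Ico 0 (T / N),
        ENNReal.ofReal ((T / N - x) ^ (-γ) / γ) ^ 2 * (4 * ENNReal.ofReal (∑ i, u i ^ 2)) := by
        refine mul_le_mul' le_rfl ?_
        refine (lintegral_le_lintegral_Ico_tsum hδ _).trans
          (setLIntegral_mono' measurableSet_Ico fun x hx => ?_)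
        rw [← tsum_enorm_sq_extend]
        exact tsum_enorm_sq_gridStep_le hγ.1 hδ hx v
    _ = _ := by
        have h4 : (4 : ℝ≥0∞) = ENNReal.ofReal 4 := by simp
        rw [h4, ← ENNReal.ofReal_mul (by norm_num),
          lintegral_mul_const' _ _ ENNReal.ofReal_ne_top,
          setLIntegral_ofReal_rpow_sq hγ.1 hγ.2 hδ, ← ENNReal.ofReal_mul (by positivity),
          ← ENNReal.ofReal_mul (by positivity)]
        congr 1
        ring

/-- L² bound on the Marchaud fractional derivative of a step function:
`∫_ℝ (D_−^γ f)² ≤ C δ^{1−2γ} Σᵢ uᵢ²`, with `C` depending only on `γ ∈ (0,1/2)`. -/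
theorem marchaudDMinus_stepFun_L2_bound (γ : ℝ) (hγ : γ ∈ Set.Ioo (0 : ℝ) (1 / 2)) :
    ∃ C > 0, ∀ T : ℝ, 0 < T → ∀ N : ℕ, 0 < N → ∀ u : Fin N → ℝ,
      (∫ t : ℝ, (marchaudDMinus γ (stepFun T N u) t) ^ 2)
        ≤ C * (T / N) ^ (1 - 2 * γ) * ∑ i, (u i) ^ 2 := by
  have hγ0 := hγ.1
  have hγ' : 0 < 1 - 2 * γ := by linarith [hγ.2]
  have hΓ : 0 < Real.Gamma (1 - γ) := Real.Gamma_pos_of_pos (by linarith)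
  refine ⟨4 * (γ / Real.Gamma (1 - γ)) ^ 2 / ((1 - 2 * γ) * γ ^ 2), by positivity,
    fun T hT N hN u => ?_⟩
  have hnonneg : 0 ≤ 4 * (γ / Real.Gamma (1 - γ)) ^ 2 / ((1 - 2 * γ) * γ ^ 2)
      * (T / N) ^ (1 - 2 * γ) * ∑ i, u i ^ 2 := by positivity
  by_cases hI : Integrable fun t => marchaudDMinus γ (stepFun T N u) t ^ 2
  · rw [← ENNReal.ofReal_le_ofReal_iff hnonneg,
      ofReal_integral_eq_lintegral_ofReal hI (ae_of_all _ fun _ => sq_nonneg _)]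
    simp only [← Real.enorm_sq]
    exact lintegral_marchaudDMinus_stepFun_le hγ hT hN u
  · rw [integral_undef hI]
    exact hnonneg
end
end
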